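/- arXiv:2306.13077 — 3 statements merged into one kernel-verified Lean document; each statement's English description precedes it below -/
import Mathlib

section
/- Let Δ ∈ ℕ. Let (G_n) be a sequence of finite connected simple graphs with |V_n| even, |V_n| → ∞ and all vertex degrees at most Δ, and let ε_n ∈ (0,1). Suppose the lazy random walks on (G_n) do not exhibit cutoff, and that there exist constants 0 < c ≤ C with c ≤ ε_n·t_mix^{G_n,lazy}(1/4) ≤ C for all n, where t_mix^{G_n,lazy} denotes the total variation mixing time of the lazy simple random walk on G_n. Then for every choice of perfect matchings η_n of V_n, the sequence of random walks on the weighted graphs (G_n*) does not exhibit cutoff. -/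
open Filter

noncomputable section

/-- A perfect matching of a vertex set: a fixed-point-free involution. -/
def IsPerfectMatchingFn {V : Type*} (η : V → V) : Prop :=
  Function.Involutive η ∧ ∀ x, η x ≠ x

/-- Probability that a uniformly random perfect matching satisfies the event `E`. -/
noncomputable def matchingProb (V : Type*) (E : (V → V) → Prop) : ℝ :=
  (Nat.card {η : V → V // IsPerfectMatchingFn η ∧ E η} : ℝ) /
    (Nat.card {η : V → V // IsPerfectMatchingFn η} : ℝ)

/-- Transition matrix of the simple random walk on a finite graph. -/
noncomputable def srwMatrix {V : Type*} [Fintype V] (G : SimpleGraph V) [DecidableRel G.Adj] :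
    Matrix V V ℝ :=
  fun x y => if G.Adj x y then ((G.degree x : ℝ))⁻¹ else 0

/-- Stationary distribution of the simple random walk: `deg x / (2|E|)`. -/
noncomputable def srwPi {V : Type*} [Fintype V] [DecidableEq V] (G : SimpleGraph V)
    [DecidableRel G.Adj] : V → ℝ :=
  fun x => (G.degree x : ℝ) / (2 * G.edgeFinset.card)

/-- The lazy version `(I + P)/2` of a transition matrix `P`. -/
noncomputable def lazyMatrix {V : Type*} [Fintype V] [DecidableEq V] (P : Matrix V V ℝ) :
    Matrix V V ℝ :=
  (2 : ℝ)⁻¹ • (1 + P)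

/-- Transition matrix of the random walk on the weighted graph `G*` obtained from `G`
by adding the matching edges `{x, η x}` with weight `ε`. -/
noncomputable def starMatrix {V : Type*} [Fintype V] [DecidableEq V] (G : SimpleGraph V)
    [DecidableRel G.Adj] (η : V → V) (ε : ℝ) : Matrix V V ℝ :=
  fun x y => ((if G.Adj x y then (1 : ℝ) else 0) + ε * (if η x = y then 1 else 0)) /
    ((G.degree x : ℝ) + ε)

/-- Stationary distribution of the random walk on `G*`. -/
noncomputable def starPi {V : Type*} [Fintype V] [DecidableEq V] (G : SimpleGraph V)
    [DecidableRel G.Adj] (ε : ℝ) : V → ℝ :=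
  fun x => ((G.degree x : ℝ) + ε) / (2 * G.edgeFinset.card + ε * Fintype.card V)

/-- The chain with transition matrix `P` and stationary distribution `stat` is mixed within
total variation distance `θ` from every starting state at time `t`. -/
def mixedAt {V : Type*} [Fintype V] [DecidableEq V] (P : Matrix V V ℝ) (stat : V → ℝ)
    (θ : ℝ) (t : ℕ) : Prop :=
  ∀ x, (2 : ℝ)⁻¹ * ∑ y, |(P ^ t) x y - stat y| ≤ θ

/-- Total variation mixing time (`sInf` over `ℕ`, so `0` if the chain never mixes). -/
noncomputable def tmix {V : Type*} [Fintype V] [DecidableEq V] (P : Matrix V V ℝ)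
    (stat : V → ℝ) (θ : ℝ) : ℕ :=
  sInf {t | mixedAt P stat θ t}

/-- Entropy of a probability vector. -/
noncomputable def entropy {V : Type*} [Fintype V] (p : V → ℝ) : ℝ :=
  ∑ y, Real.negMulLog (p y)

/-- A family of Markov chains indexed by `n`, with mixing-time function `tm n θ`,
exhibits cutoff. -/
def hasCutoff (tm : ℕ → ℝ → ℕ) : Prop :=
  ∃ t s : ℕ → ℝ, (∀ n, 0 < t n) ∧ (∀ n, 0 ≤ s n) ∧
    Tendsto (fun n => s n / t n) atTop (nhds 0) ∧
    ∀ θ ∈ Set.Ioo (0 : ℝ) 1, ∃ c : ℝ,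
      ∀ n, t n - c * s n ≤ (tm n θ : ℝ) ∧ (tm n θ : ℝ) ≤ t n + c * s n

/-- Number of vertices within graph distance `s` of `o`. -/
noncomputable def ballCard {V : Type*} (G : SimpleGraph V) (o : V) (s : ℝ) : ℕ :=
  Nat.card {y : V | (G.dist o y : ℝ) ≤ s}

/-- A vertex-transitive graph. -/
def IsVertexTransitive {V : Type*} (G : SimpleGraph V) : Prop :=
  ∀ x y : V, ∃ φ : G ≃g G, φ x = y


open scoped Matrix

/-- `P` is a stochastic matrix that is reversible with respect to the positive probability
vector `π`. -/
structure RevChain {V : Type*} [Fintype V] (P : Matrix V V ℝ) (π : V → ℝ) : Prop where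
  pos : ∀ x, 0 < π x
  sum_eq : ∑ x, π x = 1
  nonneg : ∀ x y, 0 ≤ P x y
  row : ∀ x, ∑ y, P x y = 1
  rev : ∀ x y, π x * P x y = π y * P y x

namespace RevChain

variable {V : Type*} [Fintype V] {P Q : Matrix V V ℝ} {π : V → ℝ}

theorem stationary (h : RevChain P π) (y : V) : ∑ x, π x * P x y = π y := by
  simp_rw [fun x => h.rev x y, ← Finset.mul_sum, h.row, mul_one]

theorem mulVec_const (h : RevChain P π) (c : ℝ) (x : V) : (P *ᵥ fun _ => c) x = c := by
  simp [Matrix.mulVec, dotProduct, ← Finset.sum_mul, h.row]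

theorem mulVec_mono (h : RevChain P π) {f g : V → ℝ} (hfg : ∀ x, f x ≤ g x) (x : V) :
    (P *ᵥ f) x ≤ (P *ᵥ g) x :=
  Finset.sum_le_sum fun y _ => mul_le_mul_of_nonneg_left (hfg y) (h.nonneg x y)

theorem mulVec_nonneg (h : RevChain P π) {f : V → ℝ} (hf : ∀ x, 0 ≤ f x) (x : V) :
    0 ≤ (P *ᵥ f) x :=
  Finset.sum_nonneg fun y _ => mul_nonneg (h.nonneg x y) (hf y)

theorem mulVec_le_one (h : RevChain P π) {f : V → ℝ} (hf : ∀ x, f x ≤ 1) (x : V) :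
    (P *ᵥ f) x ≤ 1 :=
  (h.mulVec_mono hf x).trans_eq (h.mulVec_const 1 x)

theorem symm_inner (h : RevChain P π) (f g : V → ℝ) :
    ∑ x, π x * (f x * (P *ᵥ g) x) = ∑ x, π x * ((P *ᵥ f) x * g x) := by
  simp only [Matrix.mulVec, dotProduct, Finset.mul_sum, Finset.sum_mul]
  rw [Finset.sum_comm]
  refine Finset.sum_congr rfl fun y _ => Finset.sum_congr rfl fun x _ => ?_
  linear_combination f x * g y * h.rev x y

theorem sum_mulVec (h : RevChain P π) (f : V → ℝ) :
    ∑ x, π x * (P *ᵥ f) x = ∑ x, π x * f x := by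
  have := h.symm_inner (fun _ => 1) f
  simpa [h.mulVec_const 1] using this

theorem sum_mulVec_sq_le (h : RevChain P π) (f : V → ℝ) :
    ∑ x, π x * (P *ᵥ f) x ^ 2 ≤ ∑ x, π x * f x ^ 2 := by
  rw [← h.sum_mulVec (fun x => f x ^ 2)]
  refine Finset.sum_le_sum fun x _ => mul_le_mul_of_nonneg_left ?_ (h.pos x).le
  have hcs := Finset.sum_mul_sq_le_sq_mul_sq Finset.univ (fun y => √(P x y))
    (fun y => √(P x y) * f y)
  have e1 : ∀ y, √(P x y) * (√(P x y) * f y) = P x y * f y := fun y => by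
    rw [← mul_assoc, Real.mul_self_sqrt (h.nonneg x y)]
  have e2 : ∀ y, (√(P x y) * f y) ^ 2 = P x y * f y ^ 2 := fun y => by
    rw [mul_pow, Real.sq_sqrt (h.nonneg x y)]
  simp_rw [e1, e2, Real.sq_sqrt (h.nonneg x _), h.row, one_mul] at hcs
  exact hcs

theorem half_sum_abs_sub_eq {p : V → ℝ} (hp : ∑ y, p y = ∑ y, π y) :
    (2 : ℝ)⁻¹ * ∑ y, |p y - π y| = ∑ y with π y < p y, (p y - π y) := by
  have h1 : ∑ y, |p y - π y| = ∑ y, (2 * (if π y < p y then p y - π y else 0) - (p y - π y)) := by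
    refine Finset.sum_congr rfl fun y _ => ?_
    split_ifs with hy
    · rw [abs_of_pos (sub_pos.2 hy)]; ring
    · rw [abs_of_nonpos (by linarith)]; ring
  rw [h1, Finset.sum_sub_distrib, Finset.sum_sub_distrib, hp, sub_self, sub_zero,
    ← Finset.mul_sum, ← Finset.sum_filter]
  ring

theorem sum_sub_le_half_sum_abs {p : V → ℝ} (hp : ∑ y, p y = ∑ y, π y) (A : Finset V) :
    ∑ y ∈ A, (π y - p y) ≤ (2 : ℝ)⁻¹ * ∑ y, |p y - π y| := by
  simp_rw [abs_sub_comm (p _)]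
  rw [half_sum_abs_sub_eq hp.symm, Finset.sum_filter]
  calc _ ≤ ∑ y ∈ A, (if p y < π y then π y - p y else 0) := by
        refine Finset.sum_le_sum fun y _ => ?_
        split_ifs <;> linarith
    _ ≤ _ := Finset.sum_le_univ_sum_of_nonneg fun y => by split_ifs <;> linarith

theorem sum_excess_succ_le (h : RevChain P π) (c : ℝ) (p : V → ℝ) :
    ∑ y, max ((∑ z, p z * P z y) - c * π y) 0 ≤ ∑ z, max (p z - c * π z) 0 := by
  calc _ ≤ ∑ y, ∑ z, max (p z - c * π z) 0 * P z y := by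
        refine Finset.sum_le_sum fun y _ => max_le ?_ ?_
        · rw [← h.stationary y, Finset.mul_sum, ← Finset.sum_sub_distrib]
          refine Finset.sum_le_sum fun z _ => ?_
          have := mul_le_mul_of_nonneg_right (le_max_left (p z - c * π z) 0) (h.nonneg z y)
          linarith
        · exact Finset.sum_nonneg fun z _ => mul_nonneg (le_max_right _ _) (h.nonneg z y)
    _ = _ := by
        rw [Finset.sum_comm]
        simp_rw [← Finset.mul_sum, h.row, mul_one]

variable [DecidableEq V]

theorem pow (h : RevChain P π) (k : ℕ) : RevChain (P ^ k) π := by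
  induction k with
  | zero =>
    refine ⟨h.pos, h.sum_eq, fun x y => ?_, fun x => ?_, fun x y => ?_⟩
    · by_cases hxy : x = y <;> simp [hxy]
    · simp [Matrix.one_apply]
    · by_cases hxy : x = y
      · simp [hxy]
      · simp [hxy, Ne.symm hxy]
  | succ k ih =>
    refine ⟨h.pos, h.sum_eq, fun x y => ?_, fun x => ?_, fun x y => ?_⟩
    · rw [pow_succ, Matrix.mul_apply]
      exact Finset.sum_nonneg fun z _ => mul_nonneg (ih.nonneg _ _) (h.nonneg _ _)
    · simp_rw [pow_succ, Matrix.mul_apply]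
      rw [Finset.sum_comm]
      simp_rw [← Finset.mul_sum, h.row, mul_one, ih.row]
    · conv_lhs => rw [pow_succ]
      conv_rhs => rw [pow_succ']
      simp_rw [Matrix.mul_apply, Finset.mul_sum]
      refine Finset.sum_congr rfl fun z _ => ?_
      linear_combination P z y * ih.rev x z + (P ^ k) z x * h.rev z y

theorem lazy (h : RevChain P π) : RevChain (lazyMatrix P) π := by
  have h0 := h.pow 0
  rw [pow_zero] at h0
  have e : ∀ x y, lazyMatrix P x y = 2⁻¹ * ((1 : Matrix V V ℝ) x y + P x y) := fun x y => rfl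
  refine ⟨h.pos, h.sum_eq, fun x y => ?_, fun x => ?_, fun x y => ?_⟩
  · rw [e]; linarith [h.nonneg x y, h0.nonneg x y]
  · simp_rw [e, ← Finset.mul_sum, Finset.sum_add_distrib, h.row, h0.row]; norm_num
  · rw [e, e]; linear_combination 2⁻¹ * h.rev x y + 2⁻¹ * h0.rev x y

theorem mixedAt_mono (h : RevChain P π) {θ : ℝ} {s t : ℕ} (hst : s ≤ t)
    (hs : mixedAt P π θ s) : mixedAt P π θ t := by
  obtain ⟨k, rfl⟩ := Nat.exists_eq_add_of_le hst
  intro x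
  refine le_trans ?_ (hs x)
  refine mul_le_mul_of_nonneg_left ?_ (by norm_num)
  have hk := h.pow k
  calc ∑ y, |(P ^ (s + k)) x y - π y|
      = ∑ y, |∑ z, ((P ^ s) x z - π z) * (P ^ k) z y| := by
        refine Finset.sum_congr rfl fun y _ => ?_
        rw [pow_add, Matrix.mul_apply]
        simp_rw [sub_mul, Finset.sum_sub_distrib, hk.stationary]
    _ ≤ ∑ y, ∑ z, |(P ^ s) x z - π z| * (P ^ k) z y := by
        refine Finset.sum_le_sum fun y _ => (Finset.abs_sum_le_sum_abs _ _).trans_eq ?_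
        refine Finset.sum_congr rfl fun z _ => ?_
        rw [abs_mul, abs_of_nonneg (hk.nonneg z y)]
    _ = ∑ z, |(P ^ s) x z - π z| := by
        rw [Finset.sum_comm]
        simp_rw [← Finset.mul_sum, hk.row, mul_one]

/-- Maximal function along even times: a function dominating `P ^ (2 n) f - 1/4` whose integral
is controlled by that of `f`. -/
theorem exists_even_majorant (h : RevChain P π) (N : ℕ) :
    ∀ f : V → ℝ, (∀ x, 0 ≤ f x) → (∀ x, f x ≤ 1) →
      ∃ v : V → ℝ, (∀ x, 0 ≤ v x) ∧ (∀ x, v x ≤ 1) ∧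
        1 / 4 * ∑ x, π x * v x ≤ ∑ x, π x * (v x * f x) ∧
        ∀ n ≤ N, ∀ y, ((P ^ (2 * n)) *ᵥ f) y ≤ 1 / 4 + v y := by
  induction N with
  | zero =>
    intro f hf0 hf1
    refine ⟨fun x => if 1 / 4 < f x then 1 else 0, fun x => by dsimp only; split_ifs <;> norm_num,
      fun x => by dsimp only; split_ifs <;> norm_num, ?_, ?_⟩
    · rw [Finset.mul_sum]
      refine Finset.sum_le_sum fun x _ => ?_
      have := h.pos x
      dsimp only
      split_ifs with hx <;> nlinarith
    · intro n hn y
      obtain rfl : n = 0 := by omega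
      simp only [mul_zero, pow_zero, Matrix.one_mulVec]
      split_ifs with hy
      · linarith [hf1 y]
      · linarith
  | succ N ih =>
    intro f hf0 hf1
    obtain ⟨v, hv0, hv1, hv, hvN⟩ := ih (P *ᵥ f) (h.mulVec_nonneg hf0) (h.mulVec_le_one hf1)
    have hPv0 := h.mulVec_nonneg hv0
    have hPv1 := h.mulVec_le_one hv1
    have hle : ∀ x, (P *ᵥ v) x ≤ if 1 / 4 < f x then 1 else (P *ᵥ v) x := fun x => by
      split_ifs
      · exact hPv1 x
      · exact le_rfl
    refine ⟨fun x => if 1 / 4 < f x then 1 else (P *ᵥ v) x, fun x => (hPv0 x).trans (hle x),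
      fun x => by dsimp only; split_ifs; exacts [le_rfl, hPv1 x], ?_, ?_⟩
    · rw [h.symm_inner, ← h.sum_mulVec v, Finset.mul_sum, ← sub_nonneg,
        ← Finset.sum_sub_distrib] at hv
      rw [Finset.mul_sum, ← sub_nonneg, ← Finset.sum_sub_distrib]
      refine hv.trans (Finset.sum_le_sum fun x _ => ?_)
      have h1 := h.pos x
      have h2 := hPv1 x
      dsimp only
      split_ifs with hx
      · nlinarith [mul_nonneg h1.le (mul_nonneg (sub_nonneg.2 h2) (sub_nonneg.2 hx.le))]
      · exact le_rfl
    · intro n hn y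
      rcases n with _ | n
      · simp only [mul_zero, pow_zero, Matrix.one_mulVec]
        split_ifs with hy
        · linarith [hf1 y]
        · linarith [hPv0 y]
      · have e : (P ^ (2 * (n + 1))) *ᵥ f = P *ᵥ ((P ^ (2 * n)) *ᵥ (P *ᵥ f)) := by
          rw [Matrix.mulVec_mulVec, Matrix.mulVec_mulVec, ← pow_succ', ← pow_succ]
          rfl
        rw [e]
        calc _ ≤ (P *ᵥ ((fun _ => 1 / 4) + v)) y :=
              h.mulVec_mono (hvN n (by omega)) y
          _ = 1 / 4 + (P *ᵥ v) y := by
              rw [Matrix.mulVec_add, Pi.add_apply, h.mulVec_const]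
          _ ≤ _ := by linarith [hle y]

theorem exists_exceptional_even (h : RevChain P π) (N : ℕ) (f : V → ℝ) (hf0 : ∀ x, 0 ≤ f x)
    (hf1 : ∀ x, f x ≤ 1) :
    ∃ B : Finset V, ∑ x ∈ B, π x ≤ 16 * ∑ x, π x * f x ∧
      ∀ y ∉ B, ∀ n ≤ N, ((P ^ (2 * n)) *ᵥ f) y ≤ 1 / 2 := by
  obtain ⟨v, hv0, hv1, hv, hvN⟩ := h.exists_even_majorant N f hf0 hf1
  refine ⟨Finset.univ.filter fun x => 1 / 4 < v x, ?_, fun y hy n hn => ?_⟩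
  · have h1 : ∑ x ∈ Finset.univ.filter (fun x => 1 / 4 < v x), π x ≤ 4 * ∑ x, π x * v x := by
      rw [Finset.sum_filter, Finset.mul_sum]
      refine Finset.sum_le_sum fun x _ => ?_
      have := h.pos x
      split_ifs with hx
      · nlinarith
      · have := mul_nonneg this.le (hv0 x); linarith
    have h2 : ∑ x, π x * (v x * f x) ≤ ∑ x, π x * f x := by
      refine Finset.sum_le_sum fun x _ => mul_le_mul_of_nonneg_left ?_ (h.pos x).le
      nlinarith [hf0 x, hv1 x]
    linarith
  · simp only [Finset.mem_filter, Finset.mem_univ, true_and, not_lt] at hy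
    linarith [hvN n hn y]

/-- Weak-type maximal inequality: outside a set of measure at most `32 π(f)`, all the functions
`P ^ k f` with `k ≤ N` are at most `1/2`. -/
theorem exists_exceptional (h : RevChain P π) (N : ℕ) (f : V → ℝ) (hf0 : ∀ x, 0 ≤ f x)
    (hf1 : ∀ x, f x ≤ 1) :
    ∃ B : Finset V, ∑ x ∈ B, π x ≤ 32 * ∑ x, π x * f x ∧
      ∀ y ∉ B, ∀ n ≤ N, ((P ^ n) *ᵥ f) y ≤ 1 / 2 := by
  obtain ⟨B₀, hB₀, h₀⟩ := h.exists_exceptional_even N f hf0 hf1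
  obtain ⟨B₁, hB₁, h₁⟩ := h.exists_exceptional_even N (P *ᵥ f) (h.mulVec_nonneg hf0)
    (h.mulVec_le_one hf1)
  rw [h.sum_mulVec] at hB₁
  refine ⟨B₀ ∪ B₁, ?_, fun y hy n hn => ?_⟩
  · have := Finset.sum_union_inter (s₁ := B₀) (s₂ := B₁) (f := π)
    have h3 : 0 ≤ ∑ x ∈ B₀ ∩ B₁, π x := Finset.sum_nonneg fun x _ => (h.pos x).le
    linarith
  · rw [Finset.notMem_union] at hy
    obtain ⟨m, rfl | rfl⟩ := Nat.even_or_odd' n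
    · exact h₀ y hy.1 m (by omega)
    · have := h₁ y hy.2 m (by omega)
      rwa [Matrix.mulVec_mulVec, ← pow_succ] at this

end RevChain

namespace RevChain

variable {V : Type*} [Fintype V] [DecidableEq V] {P : Matrix V V ℝ} {π : V → ℝ}

/-- Schur test: total variation mixing bounds the `L²` norm on mean-zero functions. -/
theorem sum_pow_mulVec_sq_le_of_mixedAt (h : RevChain P π) {θ : ℝ} {m : ℕ}
    (hm : mixedAt P π θ m) {f : V → ℝ} (hf : ∑ x, π x * f x = 0) :
    ∑ x, π x * ((P ^ m) *ᵥ f) x ^ 2 ≤ (2 * θ) ^ 2 * ∑ x, π x * f x ^ 2 := by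
  set K : V → V → ℝ := fun x y => (P ^ m) x y - π y with hK
  have hKrow : ∀ x, ∑ y, |K x y| ≤ 2 * θ := fun x => by linarith [hm x]
  have hKrev : ∀ x y, π x * |K x y| = π y * |K y x| := fun x y => by
    have := (h.pow m).rev x y
    rw [← abs_of_pos (h.pos x), ← abs_of_pos (h.pos y), ← abs_mul, ← abs_mul]
    congr 1
    simp only [hK]
    linear_combination this
  have hθ : ∀ x : V, 0 ≤ 2 * θ := fun x =>
    (Finset.sum_nonneg fun y _ => abs_nonneg (K x y)).trans (hKrow x)
  have hpt : ∀ x, ((P ^ m) *ᵥ f) x ^ 2 ≤ 2 * θ * ∑ y, |K x y| * f y ^ 2 := fun x => by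
    have e : ((P ^ m) *ᵥ f) x = ∑ y, K x y * f y := by
      simp only [hK, sub_mul, Finset.sum_sub_distrib, hf, sub_zero]
      rfl
    have hcs := Finset.sum_mul_sq_le_sq_mul_sq Finset.univ (fun y => √|K x y|)
      (fun y => √|K x y| * |f y|)
    have e1 : ∀ y, √|K x y| * (√|K x y| * |f y|) = |K x y * f y| := fun y => by
      rw [← mul_assoc, Real.mul_self_sqrt (abs_nonneg _), abs_mul]
    have e2 : ∀ y, (√|K x y| * |f y|) ^ 2 = |K x y| * f y ^ 2 := fun y => by
      rw [mul_pow, Real.sq_sqrt (abs_nonneg _), sq_abs]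
    simp_rw [e1, e2, Real.sq_sqrt (abs_nonneg (K x _))] at hcs
    have h1 : |∑ y, K x y * f y| ≤ ∑ y, |K x y * f y| := Finset.abs_sum_le_sum_abs _ _
    rw [e, ← sq_abs]
    calc |∑ y, K x y * f y| ^ 2 ≤ (∑ y, |K x y * f y|) ^ 2 :=
          pow_le_pow_left₀ (abs_nonneg _) h1 2
      _ ≤ _ := hcs
      _ ≤ _ := mul_le_mul_of_nonneg_right (hKrow x)
          (Finset.sum_nonneg fun y _ => mul_nonneg (abs_nonneg _) (sq_nonneg _))
  calc ∑ x, π x * ((P ^ m) *ᵥ f) x ^ 2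
      ≤ ∑ x, π x * (2 * θ * ∑ y, |K x y| * f y ^ 2) :=
        Finset.sum_le_sum fun x _ => mul_le_mul_of_nonneg_left (hpt x) (h.pos x).le
    _ = ∑ x, ∑ y, 2 * θ * (π y * f y ^ 2) * |K y x| := by
        refine Finset.sum_congr rfl fun x _ => ?_
        rw [Finset.mul_sum, Finset.mul_sum]
        refine Finset.sum_congr rfl fun y _ => ?_
        linear_combination 2 * θ * f y ^ 2 * hKrev x y
    _ = ∑ y, 2 * θ * (π y * f y ^ 2) * ∑ x, |K y x| := by
        rw [Finset.sum_comm]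
        simp_rw [Finset.mul_sum]
    _ ≤ ∑ y, 2 * θ * (π y * f y ^ 2) * (2 * θ) :=
        Finset.sum_le_sum fun y _ => mul_le_mul_of_nonneg_left (hKrow y)
          (mul_nonneg (hθ y) (mul_nonneg (h.pos y).le (sq_nonneg _)))
    _ = _ := by
        rw [Finset.mul_sum]
        exact Finset.sum_congr rfl fun y _ => by ring

theorem sum_pow_mulVec_sq_sq_le (h : RevChain P π) (f : V → ℝ) (k : ℕ) :
    (∑ x, π x * ((P ^ (k + 1)) *ᵥ f) x ^ 2) ^ 2 ≤
      (∑ x, π x * ((P ^ k) *ᵥ f) x ^ 2) * ∑ x, π x * ((P ^ (k + 2)) *ᵥ f) x ^ 2 := by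
  have e : ∑ x, π x * ((P ^ (k + 1)) *ᵥ f) x ^ 2 =
      ∑ x, π x * (((P ^ k) *ᵥ f) x * ((P ^ (k + 2)) *ᵥ f) x) := by
    have e1 : (P ^ (k + 1)) *ᵥ f = P *ᵥ ((P ^ k) *ᵥ f) := by
      rw [Matrix.mulVec_mulVec, ← pow_succ']
    have e2 : (P ^ (k + 2)) *ᵥ f = P *ᵥ ((P ^ (k + 1)) *ᵥ f) := by
      rw [Matrix.mulVec_mulVec, ← pow_succ']
    rw [e2, h.symm_inner, ← e1]
    exact Finset.sum_congr rfl fun x _ => by ring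
  have hcs := Finset.sum_mul_sq_le_sq_mul_sq Finset.univ
    (fun x => √(π x) * ((P ^ k) *ᵥ f) x) (fun x => √(π x) * ((P ^ (k + 2)) *ᵥ f) x)
  simp_rw [mul_pow, Real.sq_sqrt (h.pos _).le] at hcs
  rw [e]
  refine le_trans (le_of_eq ?_) hcs
  congr 1
  refine Finset.sum_congr rfl fun x _ => ?_
  have := Real.mul_self_sqrt (h.pos x).le
  linear_combination -(((P ^ k) *ᵥ f) x * ((P ^ (k + 2)) *ᵥ f) x) * this

/-- Decay of the `L²` norm by a factor `q ^ m` after `m` steps forces decay by `q` in one step. -/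
theorem sum_mulVec_sq_le_of_pow (h : RevChain P π) {f : V → ℝ} {q : ℝ} (hq : 0 < q) {m : ℕ}
    (hm : 0 < m)
    (hdec : ∑ x, π x * ((P ^ m) *ᵥ f) x ^ 2 ≤ q ^ m * ∑ x, π x * f x ^ 2) :
    ∑ x, π x * (P *ᵥ f) x ^ 2 ≤ q * ∑ x, π x * f x ^ 2 := by
  by_contra! hlt
  set a : ℕ → ℝ := fun k => ∑ x, π x * ((P ^ k) *ᵥ f) x ^ 2 with ha
  have ha0 : a 0 = ∑ x, π x * f x ^ 2 := by simp [ha]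
  have ha1 : a 1 = ∑ x, π x * (P *ᵥ f) x ^ 2 := by simp [ha]
  have hnn : 0 ≤ a 0 :=
    Finset.sum_nonneg fun x _ => mul_nonneg (h.pos x).le (sq_nonneg _)
  have hpos : 0 < a 0 := by
    have h1 := h.sum_mulVec_sq_le f
    rw [← ha0, ← ha1] at h1 hlt
    exact lt_of_lt_of_le (lt_of_le_of_lt (by positivity) hlt) h1
  have hstep : ∀ k, 0 < a k ∧ q * a k < a (k + 1) := by
    intro k
    induction k with
    | zero => exact ⟨hpos, by rwa [ha0, zero_add, ha1]⟩
    | succ k ih =>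
      obtain ⟨h1, h2⟩ := ih
      have h3 : 0 < a (k + 1) := lt_trans (by positivity) h2
      refine ⟨h3, ?_⟩
      have h4 : a (k + 1) ^ 2 ≤ a k * a (k + 2) := h.sum_pow_mulVec_sq_sq_le f k
      have h5 : a k * (q * a (k + 1)) < a k * a (k + 2) := by nlinarith
      exact lt_of_mul_lt_mul_left h5 h1.le
  have hgrow : ∀ k, q ^ (k + 1) * a 0 < a (k + 1) := by
    intro k
    induction k with
    | zero => simpa using (hstep 0).2
    | succ k ih =>
      refine lt_of_le_of_lt ?_ (hstep (k + 1)).2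
      rw [pow_succ']
      nlinarith
  obtain ⟨k, rfl⟩ := Nat.exists_eq_succ_of_ne_zero hm.ne'
  have := hgrow k
  rw [ha0] at this
  exact absurd hdec (not_le.2 this)

/-- A Poincaré inequality from total variation mixing at precision `exp (-L) / 2`. -/
theorem poincare_of_mixedAt (h : RevChain P π) {L : ℝ} {m : ℕ} (hm : 0 < m)
    (hL : 0 < L) (hLm : 2 * L ≤ m) (hmix : mixedAt P π (Real.exp (-L) / 2) m) {f : V → ℝ}
    (hf : ∑ x, π x * f x = 0) :
    L / (2 * m) * ∑ x, π x * f x ^ 2 ≤ ∑ x, π x * (f x * (f x - (P *ᵥ f) x)) := by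
  have hm' : (0 : ℝ) < m := by exact_mod_cast hm
  have h1 := h.sum_pow_mulVec_sq_le_of_mixedAt hmix hf
  have e1 : (2 * (Real.exp (-L) / 2)) ^ 2 = Real.exp (-(2 * L / m)) ^ m := by
    rw [mul_div_cancel₀ _ (two_ne_zero), ← Real.exp_nat_mul, ← Real.exp_nat_mul]
    congr 1
    field_simp
    norm_num
  rw [e1] at h1
  have h2 := h.sum_mulVec_sq_le_of_pow (Real.exp_pos _) hm h1
  have h3 : Real.exp (-(2 * L / m)) ≤ 1 - L / m := by
    have hx0 : 0 ≤ 2 * L / m := by positivity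
    have hx1 : 2 * L / m ≤ 1 := by rwa [div_le_one hm']
    have h5 : 1 + 2 * L / m ≤ Real.exp (2 * L / m) := by
      linarith [Real.add_one_le_exp (2 * L / m)]
    rw [Real.exp_neg]
    have e : L / m = (2 * L / m) / 2 := by ring
    rw [e, inv_le_iff_one_le_mul₀ (Real.exp_pos _)]
    nlinarith
  have hS : 0 ≤ ∑ x, π x * f x ^ 2 :=
    Finset.sum_nonneg fun x _ => mul_nonneg (h.pos x).le (sq_nonneg _)
  have h4 : ∑ x, π x * (P *ᵥ f) x ^ 2 ≤ (1 - L / m) * ∑ x, π x * f x ^ 2 :=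
    h2.trans (mul_le_mul_of_nonneg_right h3 hS)
  have h6 : 1 / 2 * ∑ x, π x * f x ^ 2 - 1 / 2 * ∑ x, π x * (P *ᵥ f) x ^ 2 ≤
      ∑ x, π x * (f x * (f x - (P *ᵥ f) x)) := by
    rw [Finset.mul_sum, Finset.mul_sum, ← Finset.sum_sub_distrib]
    refine Finset.sum_le_sum fun x _ => ?_
    have := mul_nonneg (h.pos x).le (sq_nonneg (f x - (P *ᵥ f) x))
    nlinarith
  have e2 : L / (2 * m) = 1 / 2 * (L / m) := by field_simp
  rw [e2]
  nlinarith

theorem lazyMatrix_mulVec (f : V → ℝ) (x : V) :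
    (lazyMatrix P *ᵥ f) x = 2⁻¹ * (f x + (P *ᵥ f) x) := by
  simp [lazyMatrix, Matrix.smul_mulVec, Matrix.add_mulVec, mul_add]

theorem sum_lazy_pow_mulVec_sq_le (h : RevChain P π) {γ : ℝ}
    (hγ : ∀ f : V → ℝ, ∑ x, π x * f x = 0 →
      γ * ∑ x, π x * f x ^ 2 ≤ ∑ x, π x * (f x * (f x - (P *ᵥ f) x)))
    (j : ℕ) {f : V → ℝ} (hf : ∑ x, π x * f x = 0) :
    ∑ x, π x * ((lazyMatrix P ^ j) *ᵥ f) x ^ 2 ≤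
      Real.exp (-(γ * j / 2)) * ∑ x, π x * f x ^ 2 := by
  induction j with
  | zero => simp
  | succ j ih =>
    set g := (lazyMatrix P ^ j) *ᵥ f with hg
    have hg0 : ∑ x, π x * g x = 0 := by rw [hg, (h.lazy.pow j).sum_mulVec, hf]
    have e : (lazyMatrix P ^ (j + 1)) *ᵥ f = lazyMatrix P *ᵥ g := by
      rw [hg, Matrix.mulVec_mulVec, ← pow_succ']
    have hS : 0 ≤ ∑ x, π x * g x ^ 2 :=
      Finset.sum_nonneg fun x _ => mul_nonneg (h.pos x).le (sq_nonneg _)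
    have h1 : ∑ x, π x * (lazyMatrix P *ᵥ g) x ^ 2 ≤ (1 - γ / 2) * ∑ x, π x * g x ^ 2 := by
      have h2 := hγ g hg0
      have h3 := h.sum_mulVec_sq_le g
      have e2 : ∑ x, π x * (lazyMatrix P *ᵥ g) x ^ 2 = 3 / 4 * ∑ x, π x * g x ^ 2
          - 1 / 2 * ∑ x, π x * (g x * (g x - (P *ᵥ g) x))
          + 1 / 4 * ∑ x, π x * (P *ᵥ g) x ^ 2 := by
        simp_rw [Finset.mul_sum, ← Finset.sum_sub_distrib, ← Finset.sum_add_distrib]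
        refine Finset.sum_congr rfl fun x _ => ?_
        rw [lazyMatrix_mulVec]
        ring
      rw [e2]
      linarith
    have h4 : 1 - γ / 2 ≤ Real.exp (-(γ / 2)) := by
      linarith [Real.add_one_le_exp (-(γ / 2))]
    have e3 : Real.exp (-(γ * (j + 1 : ℕ) / 2)) =
        Real.exp (-(γ / 2)) * Real.exp (-(γ * j / 2)) := by
      rw [← Real.exp_add]; congr 1; push_cast; ring
    rw [e, e3, mul_assoc]
    calc _ ≤ _ := h1
      _ ≤ Real.exp (-(γ / 2)) * ∑ x, π x * g x ^ 2 := mul_le_mul_of_nonneg_right h4 hS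
      _ ≤ _ := mul_le_mul_of_nonneg_left ih (Real.exp_pos _).le

end RevChain

/-- The weights of the symmetric binomial distribution with `s` trials. -/
def binomialWeight (s k : ℕ) : ℝ := (s.choose k : ℝ) / 2 ^ s

theorem binomialWeight_nonneg (s k : ℕ) : 0 ≤ binomialWeight s k := by
  unfold binomialWeight; positivity

theorem sum_binomialWeight (s : ℕ) : ∑ k ∈ Finset.range (s + 1), binomialWeight s k = 1 := by
  unfold binomialWeight
  rw [← Finset.sum_div, ← Nat.cast_sum, Nat.sum_range_choose]
  simp

theorem binomialWeight_variance (s : ℕ) :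
    ∑ k ∈ Finset.range (s + 1), ((s : ℝ) / 2 - k) ^ 2 * binomialWeight s k = (s : ℝ) / 4 := by
  have h := congrArg (Polynomial.eval (1 / 2 : ℝ)) (bernsteinPolynomial.variance ℝ s)
  rw [Polynomial.eval_finsetSum] at h
  simp only [bernsteinPolynomial, nsmul_eq_mul, Polynomial.eval_mul, Polynomial.eval_pow,
    Polynomial.eval_sub, Polynomial.eval_natCast, Polynomial.eval_X, Polynomial.eval_one] at h
  rw [show (s : ℝ) / 4 = s * (1 / 2) * (1 - 1 / 2) by ring, ← h]
  refine Finset.sum_congr rfl fun k hk => ?_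
  have hks : k ≤ s := Nat.lt_succ_iff.1 (Finset.mem_range.1 hk)
  have e : (1 / 2 : ℝ) ^ k * (1 - 1 / 2) ^ (s - k) = 1 / 2 ^ s := by
    rw [show (1 - 1 / 2 : ℝ) = 1 / 2 by norm_num, ← pow_add, Nat.add_sub_cancel' hks]
    simp
  rw [binomialWeight, mul_assoc (s.choose k : ℝ), e]
  ring

/-- Chebyshev's inequality for the symmetric binomial distribution. -/
theorem binomialWeight_tail_le (s : ℕ) {D : ℝ} (hD : 0 < D) (p : ℕ → Prop) [DecidablePred p]
    (hp : ∀ k, p k → D ≤ |(s : ℝ) / 2 - k|) :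
    ∑ k ∈ Finset.range (s + 1) with p k, binomialWeight s k ≤ s / (4 * D ^ 2) := by
  rw [le_div_iff₀ (by positivity)]
  have h : D ^ 2 * ∑ k ∈ Finset.range (s + 1) with p k, binomialWeight s k ≤ s / 4 := by
    rw [← binomialWeight_variance, Finset.mul_sum, Finset.sum_filter]
    refine Finset.sum_le_sum fun k _ => ?_
    have hb := binomialWeight_nonneg s k
    split_ifs with hk
    · refine mul_le_mul_of_nonneg_right ?_ hb
      rw [← sq_abs ((s : ℝ) / 2 - k)]
      exact pow_le_pow_left₀ hD.le (hp k hk) 2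
    · positivity
  linarith

theorem lazyMatrix_pow {V : Type*} [Fintype V] [DecidableEq V] (P : Matrix V V ℝ) (s : ℕ) :
    lazyMatrix P ^ s = ∑ k ∈ Finset.range (s + 1), binomialWeight s k • P ^ k := by
  rw [lazyMatrix, smul_pow, add_comm, (Commute.one_right P).add_pow, Finset.smul_sum]
  refine Finset.sum_congr rfl fun k _ => ?_
  rw [one_pow, mul_one, ← nsmul_eq_mul', ← Nat.cast_smul_eq_nsmul ℝ, smul_smul, binomialWeight]
  congr 1
  rw [inv_pow]
  ring

namespace RevChain

variable {V : Type*} [Fintype V] [DecidableEq V] {P S : Matrix V V ℝ} {π ϖ : V → ℝ}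

theorem mulVec_lazy_pow (f : V → ℝ) (s : ℕ) (x : V) :
    ((lazyMatrix P ^ s) *ᵥ f) x =
      ∑ k ∈ Finset.range (s + 1), binomialWeight s k * ((P ^ k) *ᵥ f) x := by
  rw [lazyMatrix_pow, Matrix.sum_mulVec, Finset.sum_apply]
  simp [Matrix.smul_mulVec]

/-- If the lazy walk at time `s` puts mass on the good set, then the walk at time `t`, where `t`
exceeds the typical number of moves of the lazy walk, puts mass outside the small set. -/
theorem lazy_pow_mulVec_le (h : RevChain P π) (s t : ℕ) {f g : V → ℝ} (hf1 : ∀ x, f x ≤ 1)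
    (hg1 : ∀ x, g x ≤ 1)
    (hfg : ∀ y, ∀ k ≤ t, ((P ^ k) *ᵥ f) y ≤ 1 - 1 / 2 * g y) (x : V) :
    ((lazyMatrix P ^ s) *ᵥ g) x ≤ 2 * (1 - ((P ^ t) *ᵥ f) x) +
      ∑ k ∈ Finset.range (s + 1) with t < k, binomialWeight s k := by
  have hu : 0 ≤ 2 * (1 - ((P ^ t) *ᵥ f) x) := by linarith [(h.pow t).mulVec_le_one hf1 x]
  generalize hU : 2 * (1 - ((P ^ t) *ᵥ f) x) = U at hu
  rw [mulVec_lazy_pow, Finset.sum_filter, ← one_mul U, ← sum_binomialWeight s,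
    Finset.sum_mul, ← Finset.sum_add_distrib]
  refine Finset.sum_le_sum fun k _ => ?_
  have hb := binomialWeight_nonneg s k
  split_ifs with hk
  · have := mul_le_mul_of_nonneg_left ((h.pow k).mulVec_le_one hg1 x) hb
    nlinarith [mul_nonneg hb hu]
  · have hk' : k ≤ t := not_lt.1 hk
    have e : (P ^ t) *ᵥ f = (P ^ k) *ᵥ ((P ^ (t - k)) *ᵥ f) := by
      rw [Matrix.mulVec_mulVec, ← pow_add, Nat.add_sub_cancel' hk']
    have h1 : ((P ^ t) *ᵥ f) x ≤ 1 - 1 / 2 * ((P ^ k) *ᵥ g) x := by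
      rw [e]
      calc _ ≤ ((P ^ k) *ᵥ ((fun _ => 1) - (1 / 2 : ℝ) • g)) x :=
            (h.pow k).mulVec_mono (fun y => hfg y (t - k) (Nat.sub_le _ _)) x
        _ = _ := by
            rw [Matrix.mulVec_sub, Matrix.mulVec_smul, Pi.sub_apply, (h.pow k).mulVec_const]
            rfl
    rw [add_zero]
    exact mul_le_mul_of_nonneg_left (by linarith) hb

/-- Lower bound comparison: partial mixing of the lazy walk forces partial mixing of a chain `S`
dominating the walk. -/
theorem mixedAt_of_lazy_mixedAt (h : RevChain P π) (hS : RevChain S ϖ) {M β : ℝ} {s t : ℕ}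
    (hM : 0 < M) (hdom : ∀ x y, (P ^ t) x y ≤ M * (S ^ t) x y) (hπ : ∀ y, π y ≤ 2 * ϖ y)
    (hβ : 0 < β)
    (htail : ∑ k ∈ Finset.range (s + 1) with t < k, binomialWeight s k ≤ β / 4)
    (hlazy : mixedAt (lazyMatrix P) π (1 - β) s) :
    mixedAt S ϖ (1 - β / (4 * (M + 32))) t := by
  intro x
  have hSt := hS.pow t
  have hPt := h.pow t
  by_contra! hlt
  rw [half_sum_abs_sub_eq (by rw [hSt.row, hS.sum_eq])] at hlt
  set A : Finset V := Finset.univ.filter fun y => ϖ y < (S ^ t) x y with hA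
  set β' := β / (4 * (M + 32)) with hβ'
  rw [Finset.sum_sub_distrib] at hlt
  have hϖA : 0 ≤ ∑ y ∈ A, ϖ y := Finset.sum_nonneg fun y _ => (hS.pos y).le
  have hsplit : ∑ y ∈ A, (S ^ t) x y + ∑ y ∈ Aᶜ, (S ^ t) x y = 1 := by
    rw [Finset.sum_add_sum_compl, hSt.row]
  have hSc : 0 ≤ ∑ y ∈ Aᶜ, (S ^ t) x y := Finset.sum_nonneg fun y _ => hSt.nonneg x y
  set f : V → ℝ := fun y => if y ∈ A then 1 else 0 with hf
  have hf0 : ∀ y, 0 ≤ f y := fun y => by simp only [hf]; split_ifs <;> norm_num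
  have hf1 : ∀ y, f y ≤ 1 := fun y => by simp only [hf]; split_ifs <;> norm_num
  obtain ⟨B, hB, hBle⟩ := h.exists_exceptional t f hf0 hf1
  have hπf : ∑ y, π y * f y = ∑ y ∈ A, π y := by
    simp [hf, Finset.sum_ite_mem]
  have hπA : ∑ y ∈ A, π y ≤ 2 * ∑ y ∈ A, ϖ y := by
    rw [Finset.mul_sum]; exact Finset.sum_le_sum fun y _ => hπ y
  have hPf : ((P ^ t) *ᵥ f) x = ∑ y ∈ A, (P ^ t) x y := by
    simp [hf, Matrix.mulVec, dotProduct, Finset.sum_ite_mem]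
  have hPsplit : ∑ y ∈ A, (P ^ t) x y + ∑ y ∈ Aᶜ, (P ^ t) x y = 1 := by
    rw [Finset.sum_add_sum_compl, hPt.row]
  have hPS : ∑ y ∈ Aᶜ, (P ^ t) x y ≤ M * ∑ y ∈ Aᶜ, (S ^ t) x y := by
    rw [Finset.mul_sum]; exact Finset.sum_le_sum fun y _ => hdom x y
  set g : V → ℝ := fun y => if y ∈ Bᶜ then 1 else 0 with hg
  have hg1 : ∀ y, g y ≤ 1 := fun y => by simp only [hg]; split_ifs <;> norm_num
  have hkey := h.lazy_pow_mulVec_le s t hf1 hg1 (fun y k hk => by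
    by_cases hy : y ∈ B
    · simpa [hg, hy] using (h.pow k).mulVec_le_one hf1 y
    · have := hBle y hy k hk
      simp only [hg, Finset.mem_compl, hy, not_false_eq_true, if_true]
      linarith) x
  have hLg : ((lazyMatrix P ^ s) *ᵥ g) x = ∑ y ∈ Bᶜ, (lazyMatrix P ^ s) x y := by
    simp [hg, Matrix.mulVec, dotProduct, Finset.sum_ite_mem, -Finset.mem_compl]
  have hLs := h.lazy.pow s
  have hTV := (sum_sub_le_half_sum_abs (π := π) (p := fun y => (lazyMatrix P ^ s) x y)
    (by rw [hLs.row, h.sum_eq]) Bᶜ).trans (hlazy x)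
  rw [Finset.sum_sub_distrib] at hTV
  have hπB : ∑ y ∈ B, π y + ∑ y ∈ Bᶜ, π y = 1 := by
    rw [Finset.sum_add_sum_compl, h.sum_eq]
  have hβ'eq : β' * (4 * (M + 32)) = β := by
    rw [hβ']; field_simp
  have h1 : ∑ y ∈ Aᶜ, (S ^ t) x y ≤ β' := by linarith
  have h2 : ∑ y ∈ A, ϖ y ≤ β' := by linarith
  have h3 : M * ∑ y ∈ Aᶜ, (S ^ t) x y ≤ M * β' := mul_le_mul_of_nonneg_left h1 hM.le
  have h4 : 0 < β' := by rw [hβ']; positivity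
  rw [hLg, hPf] at hkey
  rw [hπf] at hB
  linarith

/-- Upper bound comparison: mixing of a dominating chain `S` at time `t`, followed by `j` steps
for the `L²` contraction, mixes the lazy walk. -/
theorem lazy_mixedAt_of_mixedAt (h : RevChain P π) {M θ τ γ : ℝ} {s t j : ℕ}
    (hM : 0 < M) (hdom : ∀ x y, (P ^ t) x y ≤ M * (S ^ t) x y) (hϖ : ∀ y, ϖ y ≤ 2 * π y)
    (htail : ∑ k ∈ Finset.range (s + 1) with k < t, binomialWeight s k ≤ τ)
    (hγ : ∀ f : V → ℝ, ∑ x, π x * f x = 0 →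
      γ * ∑ x, π x * f x ^ 2 ≤ ∑ x, π x * (f x * (f x - (P *ᵥ f) x)))
    (hmix : mixedAt S ϖ θ t) :
    mixedAt (lazyMatrix P) π (2 * M * θ + τ + M * Real.exp (-(γ * j / 4))) (s + j) := by
  intro x
  set c := 2 * M with hc
  have hc0 : 0 < c := by positivity
  have hPt : ∑ y, max ((P ^ t) x y - c * π y) 0 ≤ 2 * M * θ := by
    have h1 : ∀ y, max ((P ^ t) x y - c * π y) 0 ≤ M * |(S ^ t) x y - ϖ y| := fun y => by
      refine max_le ?_ (by positivity)
      have := mul_le_mul_of_nonneg_left (le_abs_self ((S ^ t) x y - ϖ y)) hM.le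
      have := mul_le_mul_of_nonneg_left (hϖ y) hM.le
      have := hdom x y
      rw [hc]; nlinarith
    have h2 := Finset.sum_le_sum fun y (_ : y ∈ Finset.univ) => h1 y
    rw [← Finset.mul_sum] at h2
    have := mul_le_mul_of_nonneg_left (hmix x) hM.le
    linarith
  have hPk : ∀ k, t ≤ k → ∑ y, max ((P ^ k) x y - c * π y) 0 ≤ 2 * M * θ := fun k hk => by
    refine le_trans ?_ hPt
    have := (h.pow (k - t)).sum_excess_succ_le c ((P ^ t) x)
    simpa only [← Matrix.mul_apply, ← pow_add, Nat.add_sub_cancel' hk] using this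
  have hPk1 : ∀ k, ∑ y, max ((P ^ k) x y - c * π y) 0 ≤ 1 := fun k => by
    rw [← (h.pow k).row x]
    refine Finset.sum_le_sum fun y _ => max_le ?_ ((h.pow k).nonneg x y)
    have := mul_pos hc0 (h.pos y)
    linarith
  have hθ0 : 0 ≤ 2 * M * θ :=
    (Finset.sum_nonneg fun y _ => le_max_right _ _).trans hPt
  set p : V → ℝ := (lazyMatrix P ^ s) x with hp
  have hLs := h.lazy.pow s
  have hLj := h.lazy.pow j
  have hex : ∑ y, max (p y - c * π y) 0 ≤ 2 * M * θ + τ := by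
    have e : ∀ y, p y = ∑ k ∈ Finset.range (s + 1), binomialWeight s k * (P ^ k) x y :=
      fun y => by rw [hp, lazyMatrix_pow, Matrix.sum_apply]; simp
    calc _ ≤ ∑ y, ∑ k ∈ Finset.range (s + 1),
          binomialWeight s k * max ((P ^ k) x y - c * π y) 0 := by
          refine Finset.sum_le_sum fun y _ => max_le ?_ ?_
          · have e' : c * π y = ∑ k ∈ Finset.range (s + 1), binomialWeight s k * (c * π y) := by
              rw [← Finset.sum_mul, sum_binomialWeight, one_mul]
            rw [e y]
            nth_rewrite 1 [e']
            rw [← Finset.sum_sub_distrib]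
            refine Finset.sum_le_sum fun k _ => ?_
            rw [← mul_sub]
            exact mul_le_mul_of_nonneg_left (le_max_left _ _) (binomialWeight_nonneg s k)
          · exact Finset.sum_nonneg fun k _ =>
              mul_nonneg (binomialWeight_nonneg s k) (le_max_right _ _)
      _ = ∑ k ∈ Finset.range (s + 1),
          binomialWeight s k * ∑ y, max ((P ^ k) x y - c * π y) 0 := by
          rw [Finset.sum_comm]
          simp_rw [Finset.mul_sum]
      _ ≤ ∑ k ∈ Finset.range (s + 1),
          (binomialWeight s k * (2 * M * θ) + if k < t then binomialWeight s k else 0) := by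
          refine Finset.sum_le_sum fun k _ => ?_
          have hb := binomialWeight_nonneg s k
          split_ifs with hk
          · have := mul_le_mul_of_nonneg_left (hPk1 k) hb
            have := mul_nonneg hb hθ0
            linarith
          · rw [add_zero]
            exact mul_le_mul_of_nonneg_left (hPk k (not_lt.1 hk)) hb
      _ ≤ _ := by
          rw [Finset.sum_add_distrib, ← Finset.sum_mul, sum_binomialWeight, one_mul,
            ← Finset.sum_filter]
          linarith
  set r : V → ℝ := fun y => max (p y - c * π y) 0 with hr
  set d : V → ℝ := fun y => (p y - r y) / π y with hd
  have hr0 : ∀ y, 0 ≤ r y := fun y => le_max_right _ _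
  have hd_mul : ∀ y, π y * d y = p y - r y := fun y => by
    simp only [hd]; rw [mul_div_cancel₀ _ (h.pos y).ne']
  have hd0 : ∀ y, 0 ≤ d y := fun y => by
    refine div_nonneg (sub_nonneg.2 (max_le ?_ (hLs.nonneg x y))) (h.pos y).le
    have := mul_pos hc0 (h.pos y)
    linarith
  have hdc : ∀ y, d y ≤ c := fun y => by
    simp only [hd]
    rw [div_le_iff₀ (h.pos y)]
    linarith [le_max_left (p y - c * π y) 0]
  set m := ∑ y, π y * d y with hm
  have hm_eq : m = 1 - ∑ y, r y := by
    rw [hm]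
    simp_rw [hd_mul, Finset.sum_sub_distrib]
    rw [hp, hLs.row]
  set u : V → ℝ := fun y => d y - m with hu
  have hu0 : ∑ y, π y * u y = 0 := by
    simp only [hu, mul_sub, Finset.sum_sub_distrib, ← Finset.sum_mul, h.sum_eq, ← hm]
    ring
  have hu2 : ∑ y, π y * u y ^ 2 ≤ c ^ 2 := by
    have e : ∑ y, π y * u y ^ 2 = ∑ y, π y * d y ^ 2 - m ^ 2 := by
      have : ∀ y, π y * u y ^ 2 = π y * d y ^ 2 - 2 * m * (π y * d y) + m ^ 2 * π y :=
        fun y => by simp only [hu]; ring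
      simp_rw [this, Finset.sum_add_distrib, Finset.sum_sub_distrib, ← Finset.mul_sum,
        h.sum_eq, ← hm]
      ring
    have : ∑ y, π y * d y ^ 2 ≤ ∑ y, π y * c ^ 2 := Finset.sum_le_sum fun y _ =>
      mul_le_mul_of_nonneg_left (pow_le_pow_left₀ (hd0 y) (hdc y) 2) (h.pos y).le
    rw [← Finset.sum_mul, h.sum_eq, one_mul] at this
    rw [e]; nlinarith [sq_nonneg m]
  set w := (lazyMatrix P ^ j) *ᵥ u with hw
  have hw2 : ∑ y, π y * w y ^ 2 ≤ (c * Real.exp (-(γ * j / 4))) ^ 2 := by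
    have e : (c * Real.exp (-(γ * j / 4))) ^ 2 = Real.exp (-(γ * j / 2)) * c ^ 2 := by
      rw [mul_pow, ← Real.exp_nat_mul, mul_comm]
      congr 2
      push_cast; ring
    rw [e]
    exact (h.sum_lazy_pow_mulVec_sq_le hγ j hu0).trans
      (mul_le_mul_of_nonneg_left hu2 (Real.exp_pos _).le)
  have hw1 : ∑ y, π y * |w y| ≤ c * Real.exp (-(γ * j / 4)) := by
    refine le_of_sq_le_sq ?_ (by positivity)
    refine le_trans ?_ hw2
    have hcs := Finset.sum_mul_sq_le_sq_mul_sq Finset.univ (fun y => √(π y))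
      (fun y => √(π y) * |w y|)
    simp_rw [← mul_assoc, Real.mul_self_sqrt (h.pos _).le, mul_pow,
      Real.sq_sqrt (h.pos _).le, sq_abs, h.sum_eq, one_mul] at hcs
    exact hcs
  have hdecomp : ∀ y, (lazyMatrix P ^ (s + j)) x y - π y =
      ∑ z, r z * (lazyMatrix P ^ j) z y + π y * w y - (∑ z, r z) * π y := fun y => by
    have e1 : π y * w y = ∑ z, (p z - r z - m * π z) * (lazyMatrix P ^ j) z y := by
      rw [hw, Matrix.mulVec, dotProduct, Finset.mul_sum]
      refine Finset.sum_congr rfl fun z _ => ?_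
      have h1 := hLj.rev y z
      have h2 := hd_mul z
      simp only [hu]
      linear_combination (d z - m) * h1 + (lazyMatrix P ^ j) z y * h2
    have e2 : (lazyMatrix P ^ (s + j)) x y = ∑ z, p z * (lazyMatrix P ^ j) z y := by
      rw [pow_add, Matrix.mul_apply]
    have e3 : ∑ z, m * π z * (lazyMatrix P ^ j) z y = m * π y := by
      simp_rw [mul_assoc, ← Finset.mul_sum, hLj.stationary]
    rw [e1, e2]
    simp_rw [sub_mul, Finset.sum_sub_distrib]
    rw [e3, hm_eq]
    ring
  have hsum : ∑ y, |(lazyMatrix P ^ (s + j)) x y - π y| ≤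
      ∑ z, r z + ∑ y, π y * |w y| + ∑ z, r z := by
    have hR : 0 ≤ ∑ z, r z := Finset.sum_nonneg fun z _ => hr0 z
    have e1 : ∑ y, ∑ z, r z * (lazyMatrix P ^ j) z y = ∑ z, r z := by
      rw [Finset.sum_comm]
      simp_rw [← Finset.mul_sum, hLj.row, mul_one]
    have e2 : ∑ y, (∑ z, r z) * π y = ∑ z, r z := by
      rw [← Finset.mul_sum, h.sum_eq, mul_one]
    calc _ ≤ ∑ y, (∑ z, r z * (lazyMatrix P ^ j) z y + π y * |w y| + (∑ z, r z) * π y) := by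
          refine Finset.sum_le_sum fun y _ => ?_
          rw [hdecomp]
          refine (abs_sub _ _).trans ?_
          rw [abs_of_nonneg (mul_nonneg hR (h.pos y).le)]
          refine add_le_add ((abs_add_le _ _).trans (le_of_eq ?_)) le_rfl
          rw [abs_of_nonneg (Finset.sum_nonneg fun z _ => mul_nonneg (hr0 z) (hLj.nonneg z y)),
            abs_mul, abs_of_pos (h.pos y)]
      _ = _ := by rw [Finset.sum_add_distrib, Finset.sum_add_distrib, e1, e2]
  rw [hc] at hw1
  linarith

end RevChain

section Graph

variable {V : Type*} [Fintype V] (G : SimpleGraph V) [DecidableRel G.Adj]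

theorem sum_adj_eq_degree (x : V) : ∑ y, (if G.Adj x y then (1 : ℝ) else 0) = G.degree x := by
  rw [← Finset.sum_filter, Finset.sum_const, nsmul_eq_mul, mul_one,
    ← SimpleGraph.card_neighborFinset_eq_degree, SimpleGraph.neighborFinset_eq_filter]

theorem sum_degree_cast : ∑ x, (G.degree x : ℝ) = 2 * G.edgeFinset.card := by
  exact_mod_cast G.sum_degrees_eq_twice_card_edges

variable {G}

theorem card_le_two_mul_edges (hd : ∀ x, 0 < G.degree x) :
    (Fintype.card V : ℝ) ≤ 2 * G.edgeFinset.card := by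
  have h : ∑ _x : V, (1 : ℝ) ≤ ∑ x, (G.degree x : ℝ) :=
    Finset.sum_le_sum fun x _ => by exact_mod_cast hd x
  rw [sum_degree_cast] at h
  simpa using h

variable [DecidableEq V]

theorem revChain_srw [Nonempty V] (hd : ∀ x, 0 < G.degree x) :
    RevChain (srwMatrix G) (srwPi G) := by
  have hE := card_le_two_mul_edges hd
  have hV : (0 : ℝ) < Fintype.card V := by exact_mod_cast Fintype.card_pos
  have hE0 : (0 : ℝ) < 2 * G.edgeFinset.card := hV.trans_le hE
  have hd' : ∀ x, (0 : ℝ) < G.degree x := fun x => by exact_mod_cast hd x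
  refine ⟨fun x => div_pos (hd' x) hE0, ?_, fun x y => ?_, fun x => ?_, fun x y => ?_⟩
  · simp only [srwPi]
    rw [← Finset.sum_div, sum_degree_cast, div_self hE0.ne']
  · simp only [srwMatrix]; split_ifs <;> positivity
  · have e : ∀ y, srwMatrix G x y = (G.degree x : ℝ)⁻¹ * (if G.Adj x y then (1 : ℝ) else 0) :=
      fun y => by simp [srwMatrix]
    simp_rw [e, ← Finset.mul_sum, sum_adj_eq_degree]
    exact inv_mul_cancel₀ (hd' x).ne'
  · simp only [srwMatrix, srwPi, G.adj_comm y x]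
    have hx := hd' x
    have hy := hd' y
    split_ifs
    · field_simp
    · simp

theorem revChain_star [Nonempty V] (hd : ∀ x, 0 < G.degree x) {η : V → V}
    (hη : Function.Involutive η) {ε : ℝ} (hε : 0 < ε) :
    RevChain (starMatrix G η ε) (starPi G ε) := by
  have hE := card_le_two_mul_edges hd
  have hV : (0 : ℝ) < Fintype.card V := by exact_mod_cast Fintype.card_pos
  have hZ : (0 : ℝ) < 2 * G.edgeFinset.card + ε * Fintype.card V := by nlinarith
  have hd' : ∀ x, (0 : ℝ) < G.degree x + ε := fun x => by positivity
  refine ⟨fun x => div_pos (hd' x) hZ, ?_, fun x y => ?_, fun x => ?_, fun x y => ?_⟩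
  · simp only [starPi]
    rw [← Finset.sum_div, Finset.sum_add_distrib, sum_degree_cast, Finset.sum_const,
      nsmul_eq_mul, Finset.card_univ, mul_comm _ ε, div_self hZ.ne']
  · simp only [starMatrix]
    refine div_nonneg ?_ (hd' x).le
    split_ifs <;> positivity
  · simp only [starMatrix]
    rw [← Finset.sum_div, Finset.sum_add_distrib, sum_adj_eq_degree, ← Finset.mul_sum]
    simp [(hd' x).ne']
  · have e : (η x = y) = (η y = x) := by
      refine propext ⟨fun h => ?_, fun h => ?_⟩ <;> rw [← h, hη]
    simp only [starMatrix, starPi, G.adj_comm y x, e]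
    have hx := hd' x
    have hy := hd' y
    field_simp

theorem srwMatrix_le (hd : ∀ x, 0 < G.degree x) (η : V → V) {ε : ℝ} (hε : 0 < ε) (x y : V) :
    srwMatrix G x y ≤ (1 + ε) * starMatrix G η ε x y := by
  have hx : (1 : ℝ) ≤ G.degree x := by exact_mod_cast hd x
  have h1 : 0 ≤ ε * (if η x = y then (1 : ℝ) else 0) := by split_ifs <;> simp [hε.le]
  simp only [srwMatrix, starMatrix]
  generalize ε * (if η x = y then (1 : ℝ) else 0) = e at h1
  split_ifs with hxy
  · rw [mul_div_assoc', le_div_iff₀ (by positivity), inv_mul_le_iff₀ (by positivity)]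
    have h2 : (1 + ε) * 1 ≤ (1 + ε) * (1 + e) :=
      mul_le_mul_of_nonneg_left (by linarith) (by positivity)
    nlinarith
  · positivity

theorem srwMatrix_pow_le [Nonempty V] (hd : ∀ x, 0 < G.degree x) {η : V → V}
    (hη : Function.Involutive η) {ε : ℝ} (hε : 0 < ε) (t : ℕ) (x y : V) :
    (srwMatrix G ^ t) x y ≤ Real.exp (ε * t) * (starMatrix G η ε ^ t) x y := by
  have hP := revChain_srw hd
  have hS := revChain_star hd hη hε
  have key : ∀ x y, (srwMatrix G ^ t) x y ≤ (1 + ε) ^ t * (starMatrix G η ε ^ t) x y := by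
    induction t with
    | zero => simp
    | succ t ih =>
      intro x y
      rw [pow_succ, pow_succ, pow_succ, Matrix.mul_apply, Matrix.mul_apply, Finset.mul_sum]
      refine Finset.sum_le_sum fun z _ => ?_
      have := mul_le_mul (ih x z) (srwMatrix_le hd η hε z y) (hP.nonneg z y)
        (mul_nonneg (by positivity) ((hS.pow t).nonneg x z))
      linarith
  refine (key x y).trans (mul_le_mul_of_nonneg_right ?_ ((hS.pow t).nonneg x y))
  rw [mul_comm, Real.exp_nat_mul]
  refine pow_le_pow_left₀ (by positivity) ?_ t
  linarith [Real.add_one_le_exp ε]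

theorem starPi_le [Nonempty V] (hd : ∀ x, 0 < G.degree x) {ε : ℝ} (hε : 0 < ε) (hε1 : ε < 1)
    (x : V) : starPi G ε x ≤ 2 * srwPi G x := by
  have hE := card_le_two_mul_edges hd
  have hV : (0 : ℝ) < Fintype.card V := by exact_mod_cast Fintype.card_pos
  have hx : (1 : ℝ) ≤ G.degree x := by exact_mod_cast hd x
  simp only [starPi, srwPi]
  rw [mul_div_assoc']
  refine div_le_div₀ (by positivity) (by linarith) (by linarith) ?_
  linarith [mul_pos hε hV]

theorem srwPi_le [Nonempty V] (hd : ∀ x, 0 < G.degree x) {ε : ℝ} (hε : 0 < ε) (hε1 : ε < 1)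
    (x : V) : srwPi G x ≤ 2 * starPi G ε x := by
  have hE := card_le_two_mul_edges hd
  have hV : (0 : ℝ) < Fintype.card V := by exact_mod_cast Fintype.card_pos
  have hx : (1 : ℝ) ≤ G.degree x := by exact_mod_cast hd x
  simp only [starPi, srwPi]
  rw [mul_div_assoc', div_le_div_iff₀ (by linarith) (by nlinarith)]
  have h1 : ε * Fintype.card V ≤ 2 * G.edgeFinset.card := by nlinarith
  nlinarith [mul_nonneg hε.le (hV.le.trans hE)]

/-- A Poincaré inequality for the walk on `G*` yields one for the walk on `G`, with a loss of
order `ε`. -/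
theorem srw_poincare_of_star [Nonempty V] (hd : ∀ x, 0 < G.degree x) {η : V → V}
    (hη : Function.Involutive η) {ε κ : ℝ} (hε : 0 < ε) (hκ : 0 ≤ κ)
    (hstar : ∀ f : V → ℝ, ∑ x, starPi G ε x * f x = 0 →
      κ * ∑ x, starPi G ε x * f x ^ 2 ≤
        ∑ x, starPi G ε x * (f x * (f x - (starMatrix G η ε *ᵥ f) x)))
    (f : V → ℝ) (hf : ∑ x, srwPi G x * f x = 0) :
    (κ - 2 * ε) * ∑ x, srwPi G x * f x ^ 2 ≤
      ∑ x, srwPi G x * (f x * (f x - (srwMatrix G *ᵥ f) x)) := by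
  have hS := revChain_star hd hη hε
  have hE := card_le_two_mul_edges hd
  have hV : (0 : ℝ) < Fintype.card V := by exact_mod_cast Fintype.card_pos
  have hd' : ∀ x, (1 : ℝ) ≤ G.degree x := fun x => by exact_mod_cast hd x
  set Z : ℝ := 2 * G.edgeFinset.card with hZ
  set Y : ℝ := 2 * G.edgeFinset.card + ε * Fintype.card V with hY
  have hZ0 : 0 < Z := hV.trans_le hE
  have hY0 : 0 < Y := by nlinarith
  have hpi : ∀ x, srwPi G x = Z⁻¹ * G.degree x := fun x => by
    simp only [srwPi, ← hZ]; rw [div_eq_inv_mul]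
  have hpi' : ∀ x, starPi G ε x = Y⁻¹ * (G.degree x + ε) := fun x => by
    simp only [starPi, ← hY]; rw [div_eq_inv_mul]
  have hf' : ∑ x, (G.degree x : ℝ) * f x = 0 := by
    simp_rw [hpi, mul_assoc, ← Finset.mul_sum] at hf
    exact (mul_eq_zero.1 hf).resolve_left (inv_ne_zero hZ0.ne')
  have hPf : ∀ x, (G.degree x : ℝ) * (srwMatrix G *ᵥ f) x =
      ∑ y, (if G.Adj x y then (1 : ℝ) else 0) * f y := fun x => by
    have := (zero_lt_one.trans_le (hd' x)).ne'
    rw [Matrix.mulVec, dotProduct, Finset.mul_sum]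
    refine Finset.sum_congr rfl fun y _ => ?_
    simp only [srwMatrix]
    split_ifs
    · field_simp
    · simp
  have hSf : ∀ x, ((G.degree x : ℝ) + ε) * (starMatrix G η ε *ᵥ f) x =
      (∑ y, (if G.Adj x y then (1 : ℝ) else 0) * f y) + ε * f (η x) := fun x => by
    have : (G.degree x : ℝ) + ε ≠ 0 := by have := hd' x; positivity
    rw [Matrix.mulVec, dotProduct, Finset.mul_sum]
    calc _ = ∑ y, ((if G.Adj x y then (1 : ℝ) else 0) * f y +
          ε * ((if η x = y then 1 else 0) * f y)) := by
          refine Finset.sum_congr rfl fun y _ => ?_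
          simp only [starMatrix]
          field_simp
      _ = _ := by rw [Finset.sum_add_distrib, ← Finset.mul_sum]; simp
  have hreindex : ∑ x, f (η x) ^ 2 = ∑ x, f x ^ 2 :=
    Equiv.sum_comp (Function.Involutive.toPerm η hη) fun x => f x ^ 2
  obtain ⟨m, hm⟩ : ∃ m, m = ∑ x, starPi G ε x * f x := ⟨_, rfl⟩
  have hcenter : ∑ x, starPi G ε x * (f x - m) = 0 := by
    simp only [mul_sub, Finset.sum_sub_distrib, ← Finset.sum_mul, hS.sum_eq, ← hm]
    ring
  have hmain := hstar (fun x => f x - m) hcenter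
  have hshift : ∀ x, (starMatrix G η ε *ᵥ fun x => f x - m) x =
      (starMatrix G η ε *ᵥ f) x - m := fun x => by
    have : (fun x => f x - m) = f - fun _ => m := rfl
    rw [this, Matrix.mulVec_sub, Pi.sub_apply, hS.mulVec_const]
  have hform : ∑ x, starPi G ε x *
      ((f x - m) * (f x - m - (starMatrix G η ε *ᵥ fun x => f x - m) x)) =
      Y⁻¹ * (∑ x, (G.degree x : ℝ) * (f x * (f x - (srwMatrix G *ᵥ f) x)) +
        ε * ∑ x, (f x ^ 2 - f x * f (η x))) := by
    have e1 : ∑ x, starPi G ε x *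
        ((f x - m) * (f x - m - (starMatrix G η ε *ᵥ fun x => f x - m) x)) =
        ∑ x, starPi G ε x * (f x * (f x - (starMatrix G η ε *ᵥ f) x)) -
          m * (∑ x, starPi G ε x * f x - ∑ x, starPi G ε x * (starMatrix G η ε *ᵥ f) x) := by
      rw [← Finset.sum_sub_distrib, Finset.mul_sum, ← Finset.sum_sub_distrib]
      refine Finset.sum_congr rfl fun x _ => ?_
      rw [hshift]; ring
    rw [e1, hS.sum_mulVec, sub_self, mul_zero, sub_zero,
      Finset.mul_sum _ _ ε, ← Finset.sum_add_distrib, Finset.mul_sum]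
    refine Finset.sum_congr rfl fun x _ => ?_
    rw [hpi']
    linear_combination Y⁻¹ * f x * hPf x - Y⁻¹ * f x * hSf x
  have hnorm : Y⁻¹ * ∑ x, (G.degree x : ℝ) * f x ^ 2 ≤
      ∑ x, starPi G ε x * (f x - m) ^ 2 := by
    simp_rw [hpi', mul_assoc, ← Finset.mul_sum]
    refine mul_le_mul_of_nonneg_left ?_ (inv_nonneg.2 hY0.le)
    have e2 : ∑ x, ((G.degree x : ℝ) * f x ^ 2) =
        ∑ x, ((G.degree x : ℝ) * (f x ^ 2 - 2 * m * f x)) := by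
      simp_rw [mul_sub, Finset.sum_sub_distrib]
      have : ∑ x, (G.degree x : ℝ) * (2 * m * f x) = 0 := by
        rw [← mul_zero (2 * m), ← hf', Finset.mul_sum]
        exact Finset.sum_congr rfl fun x _ => by ring
      rw [this, sub_zero]
    rw [e2]
    refine Finset.sum_le_sum fun x _ => ?_
    have := hd' x
    nlinarith [mul_nonneg hε.le (sq_nonneg (f x - m)),
      mul_nonneg (zero_le_one.trans this) (sq_nonneg m)]
  have hmatch : ∑ x, (f x ^ 2 - f x * f (η x)) ≤ 2 * ∑ x, (G.degree x : ℝ) * f x ^ 2 := by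
    calc _ ≤ ∑ x, (3 / 2 * f x ^ 2 + 1 / 2 * f (η x) ^ 2) := by
          refine Finset.sum_le_sum fun x _ => ?_
          nlinarith [sq_nonneg (f x + f (η x))]
      _ = 2 * ∑ x, f x ^ 2 := by
          rw [Finset.sum_add_distrib, ← Finset.mul_sum, ← Finset.mul_sum, hreindex]; ring
      _ ≤ _ := by
          refine mul_le_mul_of_nonneg_left (Finset.sum_le_sum fun x _ => ?_) (by norm_num)
          nlinarith [hd' x, sq_nonneg (f x)]
  rw [hform] at hmain
  have h1 := (mul_le_mul_of_nonneg_left hnorm hκ).trans hmain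
  rw [mul_left_comm] at h1
  have h2 := le_of_mul_le_mul_left h1 (inv_pos.2 hY0)
  have h3 := mul_le_mul_of_nonneg_left hmatch hε.le
  simp_rw [hpi, mul_assoc, ← Finset.mul_sum]
  rw [mul_left_comm]
  refine mul_le_mul_of_nonneg_left ?_ (inv_nonneg.2 hZ0.le)
  linarith

/-- The walk on `G*` cannot be mixed to high precision in a bounded number of steps on a large
graph of bounded degree. -/
theorem pow_le_of_star_mixedAt [Nonempty V] (hd : ∀ x, 0 < G.degree x) {Δ : ℕ}
    (hΔ : ∀ x, G.degree x ≤ Δ) {η : V → V} (hη : Function.Involutive η) {ε : ℝ} (hε : 0 < ε)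
    (hε1 : ε < 1) {θ : ℝ} {m : ℕ} (hmix : mixedAt (starMatrix G η ε) (starPi G ε) θ m) :
    ((Δ + 1 : ℝ)⁻¹) ^ m ≤ 2 * θ + (Δ + 1) / Fintype.card V := by
  have hS := revChain_star hd hη hε
  have hE := card_le_two_mul_edges hd
  have hV : (0 : ℝ) < Fintype.card V := by exact_mod_cast Fintype.card_pos
  have hΔ' : ∀ x, (G.degree x : ℝ) ≤ Δ := fun x => by exact_mod_cast hΔ x
  obtain ⟨x⟩ := ‹Nonempty V›
  have hpath : ∃ y, ((Δ + 1 : ℝ)⁻¹) ^ m ≤ (starMatrix G η ε ^ m) x y := by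
    clear hmix
    induction m with
    | zero => exact ⟨x, by simp⟩
    | succ m ih =>
      obtain ⟨y, hy⟩ := ih
      obtain ⟨z, hz⟩ := (G.degree_pos_iff_exists_adj y).1 (hd y)
      refine ⟨z, ?_⟩
      have h1 : (Δ + 1 : ℝ)⁻¹ ≤ starMatrix G η ε y z := by
        simp only [starMatrix, hz, if_true]
        rw [inv_eq_one_div]
        refine div_le_div₀ ?_ ?_ (by positivity) (by linarith [hΔ' y])
        · split_ifs <;> positivity
        · split_ifs <;> simp [hε.le]
      rw [pow_succ, pow_succ, Matrix.mul_apply]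
      calc _ ≤ (starMatrix G η ε ^ m) x y * starMatrix G η ε y z :=
            mul_le_mul hy h1 (by positivity) ((hS.pow m).nonneg x y)
        _ ≤ _ := Finset.single_le_sum
            (f := fun w => (starMatrix G η ε ^ m) x w * starMatrix G η ε w z)
            (fun w _ => mul_nonneg ((hS.pow m).nonneg x w) (hS.nonneg w z))
            (Finset.mem_univ y)
  obtain ⟨y, hy⟩ := hpath
  have h1 : |(starMatrix G η ε ^ m) x y - starPi G ε y| ≤ 2 * θ := by
    have h2 := Finset.single_le_sum
      (f := fun y => |(starMatrix G η ε ^ m) x y - starPi G ε y|)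
      (fun w _ => abs_nonneg _) (Finset.mem_univ y)
    have h3 := hmix x
    linarith
  have h4 : starPi G ε y ≤ (Δ + 1) / Fintype.card V := by
    simp only [starPi]
    refine div_le_div₀ (by positivity) (by linarith [hΔ' y]) hV ?_
    nlinarith
  linarith [le_abs_self ((starMatrix G η ε ^ m) x y - starPi G ε y)]

end Graph

section Graph

variable {V : Type*} [Fintype V] [DecidableEq V] {G : SimpleGraph V} [DecidableRel G.Adj]
  [Nonempty V]

/-- Mixing of the walk on `G*` shortly after time `t ≲ 1/ε` gives a spectral gap of order at least
`Γ / t` for the walk on `G`. -/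
theorem srw_poincare_of_star_mixedAt (hd : ∀ x, 0 < G.degree x) {η : V → V}
    (hη : Function.Involutive η) {ε t C Γ : ℝ} (hε : 0 < ε) (hεt : ε * t ≤ C)
    (ht : 1 ≤ t) (hC : 0 < C) (hΓ : 0 < Γ) (htΓ : 6 * Γ + 12 * C ≤ t)
    (hmix : ∀ m : ℕ, 2 * t ≤ m →
      mixedAt (starMatrix G η ε) (starPi G ε) (Real.exp (-(6 * Γ + 12 * C)) / 2) m)
    (f : V → ℝ) (hf : ∑ x, srwPi G x * f x = 0) :
    Γ / t * ∑ x, srwPi G x * f x ^ 2 ≤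
      ∑ x, srwPi G x * (f x * (f x - (srwMatrix G *ᵥ f) x)) := by
  have hS := revChain_star hd hη hε
  have hm1 : 2 * t ≤ (⌈2 * t⌉₊ : ℝ) := Nat.le_ceil _
  have hm2 : (⌈2 * t⌉₊ : ℝ) ≤ 3 * t := by
    linarith [Nat.ceil_lt_add_one (show 0 ≤ 2 * t by linarith)]
  have hm0 : 0 < ⌈2 * t⌉₊ := Nat.ceil_pos.2 (by linarith)
  have hL : 0 < 6 * Γ + 12 * C := by positivity
  have hS0 : 0 ≤ ∑ x, srwPi G x * f x ^ 2 :=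
    Finset.sum_nonneg fun x _ => mul_nonneg ((revChain_srw hd).pos x).le (sq_nonneg _)
  refine le_trans (mul_le_mul_of_nonneg_right ?_ hS0)
    (srw_poincare_of_star hd hη hε (κ := (6 * Γ + 12 * C) / (2 * ⌈2 * t⌉₊)) (by positivity)
      (fun g hg => hS.poincare_of_mixedAt hm0 hL (by linarith) (hmix _ hm1) hg) f hf)
  have h1 : (6 * Γ + 12 * C) / (2 * (3 * t)) ≤ (6 * Γ + 12 * C) / (2 * ⌈2 * t⌉₊) := by
    have : (0 : ℝ) < ⌈2 * t⌉₊ := by exact_mod_cast hm0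
    gcongr
  have h2 : ε ≤ C / t := by rwa [le_div_iff₀ (by linarith)]
  have h3 : (6 * Γ + 12 * C) / (2 * (3 * t)) = Γ / t + 2 * (C / t) := by
    field_simp; ring
  linarith

/-- Upper bound on the mixing time of the lazy walk on `G` in terms of that on `G*`. -/
theorem lazy_mixedAt_of_star_mixedAt (hd : ∀ x, 0 < G.degree x) {η : V → V}
    (hη : Function.Involutive η) {ε t C δ θ : ℝ} (hε : 0 < ε) (hε1 : ε < 1) (hεt : ε * t ≤ C)
    (hδ : 0 < δ) (hδ1 : δ ≤ 1 / 4) (hθ : 0 < θ) (ht : 1 ≤ t) (htδ : 2 ≤ 3 * δ * t)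
    (htθ : 5 / (δ ^ 2 * θ) ≤ t)
    (hmix : ∀ m : ℕ, (1 + δ) * t ≤ m →
      mixedAt (starMatrix G η ε) (starPi G ε) (θ / (8 * Real.exp (3 * C))) m)
    (hgap : ∀ f : V → ℝ, ∑ x, srwPi G x * f x = 0 →
      4 / δ * Real.log (2 * Real.exp (3 * C) / θ) / t * ∑ x, srwPi G x * f x ^ 2 ≤
        ∑ x, srwPi G x * (f x * (f x - (srwMatrix G *ᵥ f) x)))
    (hθ1 : θ < 1) (hC : 0 < C) (m : ℕ) (hm : 2 * (1 + 4 * δ) * t ≤ m) :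
    mixedAt (lazyMatrix (srwMatrix G)) (srwPi G) θ m := by
  have hP := revChain_srw hd
  obtain ⟨a, ha⟩ : ∃ a, a = ⌈(1 + δ) * t⌉₊ := ⟨_, rfl⟩
  obtain ⟨s, hs⟩ : ∃ s, s = ⌈2 * (1 + 2 * δ) * t⌉₊ := ⟨_, rfl⟩
  obtain ⟨j, hj⟩ : ∃ j, j = ⌈δ * t⌉₊ := ⟨_, rfl⟩
  have hδt : 0 < δ * t := by positivity
  have hδt1 : δ * t ≤ 1 / 4 * t := mul_le_mul_of_nonneg_right hδ1 (by linarith)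
  have ha1 : (1 + δ) * t ≤ a := ha ▸ Nat.le_ceil _
  have ha2 : (a : ℝ) < (1 + δ) * t + 1 := ha ▸ Nat.ceil_lt_add_one (by positivity)
  have hs1 : 2 * (1 + 2 * δ) * t ≤ s := hs ▸ Nat.le_ceil _
  have hs2 : (s : ℝ) < 2 * (1 + 2 * δ) * t + 1 := hs ▸ Nat.ceil_lt_add_one (by positivity)
  have hj1 : δ * t ≤ j := hj ▸ Nat.le_ceil _
  have hj2 : (j : ℝ) < δ * t + 1 := hj ▸ Nat.ceil_lt_add_one (by positivity)
  set M := Real.exp (3 * C) with hM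
  have hM0 : 0 < M := Real.exp_pos _
  have hM1 : 1 ≤ M := Real.one_le_exp (by positivity)
  have hdom : ∀ x y, (srwMatrix G ^ a) x y ≤ M * (starMatrix G η ε ^ a) x y := fun x y => by
    refine (srwMatrix_pow_le hd hη hε a x y).trans
      (mul_le_mul_of_nonneg_right (Real.exp_le_exp.2 ?_)
        (((revChain_star hd hη hε).pow a).nonneg x y))
    have : ε * a ≤ ε * (3 * t) := mul_le_mul_of_nonneg_left (by linarith) hε.le
    linarith
  have htail : ∑ k ∈ Finset.range (s + 1) with k < a, binomialWeight s k ≤ θ / 4 := by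
    refine (binomialWeight_tail_le s hδt _ fun k hk => ?_).trans ?_
    · have hk' : (k : ℝ) < (1 + δ) * t := by rw [ha] at hk; exact Nat.lt_ceil.1 hk
      exact le_trans (by linarith) (le_abs_self _)
    · rw [div_le_iff₀ (by positivity)]
      rw [div_le_iff₀ (by positivity)] at htθ
      have h5 : 5 * t ≤ t * (δ ^ 2 * θ) * t := mul_le_mul_of_nonneg_right htθ (by linarith)
      nlinarith
  have hlog : 0 < Real.log (2 * M / θ) := by
    refine Real.log_pos ?_
    rw [lt_div_iff₀ hθ]
    linarith
  have hexp : M * Real.exp (-(4 / δ * Real.log (2 * M / θ) / t * j / 4)) ≤ θ / 2 := by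
    have h1 : Real.log (2 * M / θ) ≤ 4 / δ * Real.log (2 * M / θ) / t * j / 4 := by
      have e : 4 / δ * Real.log (2 * M / θ) / t * j / 4 =
          Real.log (2 * M / θ) * (j / (δ * t)) := by field_simp
      rw [e]
      exact le_mul_of_one_le_right hlog.le ((one_le_div hδt).2 hj1)
    calc _ ≤ M * Real.exp (-Real.log (2 * M / θ)) := by gcongr
      _ = θ / 2 := by
          rw [Real.exp_neg, Real.exp_log (by positivity)]
          field_simp
  have hsj : s + j ≤ m := by
    have : ((s + j : ℕ) : ℝ) ≤ m := by push_cast; linarith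
    exact_mod_cast this
  refine hP.lazy.mixedAt_mono hsj fun x => ?_
  refine (hP.lazy_mixedAt_of_mixedAt hM0 hdom (starPi_le hd hε hε1) htail hgap
    (hmix a ha1) x).trans ?_
  have e : 2 * M * (θ / (8 * M)) = θ / 4 := by field_simp; norm_num
  rw [e]
  linarith

/-- Lower bound on the mixing time of the lazy walk on `G` in terms of that on `G*`. -/
theorem not_lazy_mixedAt_of_star (hd : ∀ x, 0 < G.degree x) {η : V → V}
    (hη : Function.Involutive η) {ε t C δ θ : ℝ} (hε : 0 < ε) (hε1 : ε < 1) (hεt : ε * t ≤ C)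
    (hδ : 0 < δ) (hδ1 : δ ≤ 1 / 4) (hθ1 : θ < 1) (ht : 1 ≤ t)
    (htθ : 2 / (δ ^ 2 * (1 - θ)) ≤ t)
    (hmix : ∀ m : ℕ, m ≤ (1 - δ) * t →
      ¬ mixedAt (starMatrix G η ε) (starPi G ε) (1 - (1 - θ) / (4 * (Real.exp C + 32))) m)
    (m : ℕ) (hm : m ≤ 2 * (1 - 2 * δ) * t) :
    ¬ mixedAt (lazyMatrix (srwMatrix G)) (srwPi G) θ m := by
  intro hmixed
  have hP := revChain_srw hd
  obtain ⟨a, ha⟩ : ∃ a, a = ⌊(1 - δ) * t⌋₊ := ⟨_, rfl⟩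
  have hδt : 0 < δ * t := by positivity
  have ha1 : (a : ℝ) ≤ (1 - δ) * t := ha ▸ Nat.floor_le (by nlinarith)
  refine hmix a ha1 (hP.mixedAt_of_lazy_mixedAt (revChain_star hd hη hε) (Real.exp_pos C)
    (fun x y => ?_) (srwPi_le hd hε hε1) (sub_pos.2 hθ1) (s := m) ?_ (by simpa using hmixed))
  · refine (srwMatrix_pow_le hd hη hε a x y).trans
      (mul_le_mul_of_nonneg_right (Real.exp_le_exp.2 ?_)
        (((revChain_star hd hη hε).pow a).nonneg x y))
    have : ε * a ≤ ε * t := mul_le_mul_of_nonneg_left (by linarith) hε.le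
    linarith
  · refine (binomialWeight_tail_le m hδt _ fun k hk => ?_).trans ?_
    · have hk' : (1 - δ) * t < k := by rw [ha] at hk; exact Nat.lt_of_floor_lt hk
      rw [abs_sub_comm]
      exact le_trans (by linarith) (le_abs_self _)
    · have h1 : 0 < 1 - θ := sub_pos.2 hθ1
      rw [div_le_iff₀ (by positivity)]
      rw [div_le_iff₀ (by positivity)] at htθ
      have h5 : 2 * t ≤ t * (δ ^ 2 * (1 - θ)) * t :=
        mul_le_mul_of_nonneg_right htθ (by linarith)
      nlinarith

end Graph

theorem hasCutoff.exists_tendsto {tm : ℕ → ℝ → ℕ} (h : hasCutoff tm) :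
    ∃ t : ℕ → ℝ, (∀ n, 0 < t n) ∧
      ∀ θ ∈ Set.Ioo (0 : ℝ) 1, Tendsto (fun n => (tm n θ : ℝ) / t n) atTop (nhds 1) := by
  obtain ⟨t, s, ht, hs, hst, hc⟩ := h
  refine ⟨t, ht, fun θ hθ => ?_⟩
  obtain ⟨c, hc⟩ := hc θ hθ
  have hlim : Tendsto (fun n => c * (s n / t n)) atTop (nhds 0) := by
    simpa using hst.const_mul c
  rw [tendsto_iff_dist_tendsto_zero]
  refine squeeze_zero (fun n => dist_nonneg) (fun n => ?_) hlim
  have e : (tm n θ : ℝ) / t n - 1 = (tm n θ - t n) / t n := by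
    rw [sub_div, div_self (ht n).ne']
  rw [Real.dist_eq, e, abs_div, abs_of_pos (ht n), mul_div_assoc']
  refine div_le_div_of_nonneg_right ?_ (ht n).le
  rw [abs_le]
  constructor <;> linarith [(hc n).1, (hc n).2]

theorem hasCutoff_of_tendsto {tm : ℕ → ℝ → ℕ} {t : ℕ → ℝ} (ht : ∀ n, 0 < t n)
    (hlim : ∀ θ ∈ Set.Ioo (0 : ℝ) 1, Tendsto (fun n => (tm n θ : ℝ) / t n) atTop (nhds 1))
    (hanti : ∀ θ₁ ∈ Set.Ioo (0 : ℝ) 1, ∀ θ₂, θ₁ ≤ θ₂ → ∀ᶠ n in atTop, tm n θ₂ ≤ tm n θ₁) :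
    hasCutoff tm := by
  set u : ℕ → ℝ := fun k => 1 / ((k : ℝ) + 2) with hu
  have hu0 : ∀ k, 0 < u k := fun k => by simp only [hu]; positivity
  have hu1 : ∀ k, u k < 1 := fun k => by
    simp only [hu]
    rw [div_lt_one (by positivity)]
    linarith [Nat.cast_nonneg (α := ℝ) k]
  set r : ℕ → ℕ → ℝ := fun n k =>
    |(tm n (u k) : ℝ) / t n - 1| + |(tm n (1 - u k) : ℝ) / t n - 1| with hr
  have hr0 : ∀ n k, 0 ≤ r n k := fun n k => by positivity
  have hrlim : ∀ k, Tendsto (fun n => r n k) atTop (nhds 0) := fun k => by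
    have h1 := ((hlim (u k) ⟨hu0 k, hu1 k⟩).sub_const 1).abs
    have h2 := ((hlim (1 - u k) ⟨by linarith [hu1 k], by linarith [hu0 k]⟩).sub_const 1).abs
    simpa using h1.add h2
  set b : ℕ → ℕ → ℝ := fun n k => (1 / 2 : ℝ) ^ k * min 1 (r n k) with hb
  have hb0 : ∀ n k, 0 ≤ b n k := fun n k =>
    mul_nonneg (by positivity) (le_min zero_le_one (hr0 n k))
  have hble : ∀ n k, b n k ≤ (1 / 2 : ℝ) ^ k := fun n k =>
    mul_le_of_le_one_right (by positivity) (min_le_left _ _)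
  have hbs : ∀ n, Summable (b n) := fun n =>
    Summable.of_nonneg_of_le (hb0 n) (hble n) summable_geometric_two
  have hblim : Tendsto (fun n => ∑' k, b n k) atTop (nhds 0) := by
    have hbk : ∀ k, Tendsto (fun n => b n k) atTop (nhds 0) := fun k => by
      have h := (Tendsto.min (tendsto_const_nhds (x := (1 : ℝ))) (hrlim k)).const_mul
        ((1 / 2 : ℝ) ^ k)
      rw [min_eq_right zero_le_one, mul_zero] at h
      exact h
    have := tendsto_tsum_of_dominated_convergence (f := b) (g := fun _ => (0 : ℝ))
      (𝓕 := atTop) (bound := fun k : ℕ => (1 / 2 : ℝ) ^ k) summable_geometric_two hbk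
      (Eventually.of_forall fun n k => by
        rw [Real.norm_of_nonneg (hb0 n k)]; exact hble n k)
    simpa using this
  set s : ℕ → ℝ := fun n => t n * (∑' k, b n k + 1 / ((n : ℝ) + 1)) with hs
  have hbn : ∀ n, 0 ≤ ∑' k, b n k := fun n => tsum_nonneg (hb0 n)
  have hs0 : ∀ n, 0 < s n := fun n =>
    mul_pos (ht n) (add_pos_of_nonneg_of_pos (hbn n) (by positivity))
  refine ⟨t, s, ht, fun n => (hs0 n).le, ?_, fun θ hθ => ?_⟩
  · have e : ∀ n, s n / t n = ∑' k, b n k + 1 / ((n : ℝ) + 1) := fun n => by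
      simp only [hs]; rw [mul_div_cancel_left₀ _ (ht n).ne']
    simp_rw [e]
    simpa using hblim.add tendsto_one_div_add_atTop_nhds_zero_nat
  · obtain ⟨k, hk⟩ := exists_nat_one_div_lt (lt_min hθ.1 (sub_pos.2 hθ.2))
    have huk : u k < min θ (1 - θ) := by
      refine lt_of_le_of_lt ?_ hk
      simp only [hu]
      exact one_div_le_one_div_of_le (by positivity) (by linarith)
    have h1 := hanti (u k) ⟨hu0 k, hu1 k⟩ θ (huk.le.trans (min_le_left _ _))
    have h2 := hanti θ hθ (1 - u k) (by linarith [huk.le.trans (min_le_right _ _)])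
    have h3 := (hrlim k).eventually (ge_mem_nhds zero_lt_one)
    obtain ⟨N, hN⟩ := eventually_atTop.1 (h1.and (h2.and h3))
    set c₀ := ∑ n ∈ Finset.range N, |(tm n θ : ℝ) - t n| / s n with hc₀
    have hterm : ∀ n, 0 ≤ |(tm n θ : ℝ) - t n| / s n := fun n =>
      div_nonneg (abs_nonneg _) (hs0 n).le
    have hc₀0 : 0 ≤ c₀ := Finset.sum_nonneg fun n _ => hterm n
    have key : ∀ n, |(tm n θ : ℝ) - t n| ≤ (2 ^ k + c₀) * s n := fun n => by
      rcases lt_or_ge n N with hn | hn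
      · have h4 : |(tm n θ : ℝ) - t n| / s n ≤ c₀ :=
          Finset.single_le_sum (f := fun n => |(tm n θ : ℝ) - t n| / s n)
            (fun n _ => hterm n) (Finset.mem_range.2 hn)
        rw [div_le_iff₀ (hs0 n)] at h4
        have : 0 ≤ 2 ^ k * s n := mul_nonneg (by positivity) (hs0 n).le
        linarith
      · obtain ⟨h5, h6, h7⟩ := hN n hn
        have h5' : (tm n θ : ℝ) ≤ tm n (u k) := by exact_mod_cast h5
        have h6' : (tm n (1 - u k) : ℝ) ≤ tm n θ := by exact_mod_cast h6
        have h8 : r n k = 2 ^ k * b n k := by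
          simp only [hb]
          rw [min_eq_right h7, ← mul_assoc, ← mul_pow]
          norm_num
        have h9 : b n k ≤ ∑' k, b n k := (hbs n).le_tsum k fun i _ => hb0 n i
        have h10 : |(tm n θ : ℝ) / t n - 1| ≤ r n k := by
          have h11 := div_le_div_of_nonneg_right h5' (ht n).le
          have h12 := div_le_div_of_nonneg_right h6' (ht n).le
          have h13 := le_abs_self ((tm n (u k) : ℝ) / t n - 1)
          have h14 := neg_abs_le ((tm n (1 - u k) : ℝ) / t n - 1)
          have h15 := abs_nonneg ((tm n (u k) : ℝ) / t n - 1)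
          have h16 := abs_nonneg ((tm n (1 - u k) : ℝ) / t n - 1)
          simp only [hr]
          rw [abs_le]
          constructor <;> linarith
        have e : |(tm n θ : ℝ) - t n| = t n * |(tm n θ : ℝ) / t n - 1| := by
          rw [← abs_of_pos (ht n), ← abs_mul, abs_of_pos (ht n), mul_sub,
            mul_div_cancel₀ _ (ht n).ne', mul_one]
        have h17 : r n k ≤ 2 ^ k * (∑' k, b n k + 1 / ((n : ℝ) + 1)) := by
          rw [h8]
          refine mul_le_mul_of_nonneg_left ?_ (by positivity)
          have : (0 : ℝ) ≤ 1 / ((n : ℝ) + 1) := by positivity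
          linarith
        calc _ = t n * |(tm n θ : ℝ) / t n - 1| := e
          _ ≤ t n * (2 ^ k * (∑' k, b n k + 1 / ((n : ℝ) + 1))) :=
              mul_le_mul_of_nonneg_left (h10.trans h17) (ht n).le
          _ = 2 ^ k * s n := by simp only [hs]; ring
          _ ≤ _ := by
              have := mul_nonneg hc₀0 (hs0 n).le
              linarith
    refine ⟨2 ^ k + c₀, fun n => ?_⟩
    have := abs_le.1 (key n)
    constructor <;> linarith [this.1, this.2]

section Tmix

variable {V : Type*} [Fintype V] [DecidableEq V] {P : Matrix V V ℝ} {π : V → ℝ} {θ : ℝ}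

theorem mixedAt_tmix_of_exists (h : ∃ m, mixedAt P π θ m) : mixedAt P π θ (tmix P π θ) :=
  Nat.sInf_mem (s := {t | mixedAt P π θ t}) h

theorem mixedAt_tmix_of_pos (h : 0 < tmix P π θ) : mixedAt P π θ (tmix P π θ) :=
  mixedAt_tmix_of_exists (Nat.nonempty_of_pos_sInf h)

theorem tmix_le {m : ℕ} (h : mixedAt P π θ m) : tmix P π θ ≤ m :=
  Nat.sInf_le h

theorem tmix_anti {θ' : ℝ} (hθ : θ ≤ θ') (h : ∃ m, mixedAt P π θ m) :
    tmix P π θ' ≤ tmix P π θ :=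
  tmix_le fun x => (mixedAt_tmix_of_exists h x).trans hθ

end Tmix

section Family

variable {V : ℕ → Type} [∀ n, Fintype (V n)] [∀ n, DecidableEq (V n)]
  {P : ∀ n, Matrix (V n) (V n) ℝ} {π : ∀ n, V n → ℝ} {t : ℕ → ℝ}

theorem eventually_mixedAt_of_tendsto (hP : ∀ n, RevChain (P n) (π n)) (ht : ∀ n, 0 < t n)
    {θ : ℝ} (hlim : Tendsto (fun n => (tmix (P n) (π n) θ : ℝ) / t n) atTop (nhds 1))
    {δ : ℝ} (hδ : 0 < δ) :
    ∀ᶠ n in atTop, ∀ m : ℕ, (1 + δ) * t n ≤ m → mixedAt (P n) (π n) θ m := by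
  filter_upwards [(tendsto_order.1 hlim).1 0 one_pos,
    (tendsto_order.1 hlim).2 (1 + δ) (by linarith)] with n h0 h1 m hm
  have hpos : 0 < tmix (P n) (π n) θ := by
    rw [Nat.pos_iff_ne_zero]
    intro h
    simp [h] at h0
  rw [div_lt_iff₀ (ht n)] at h1
  have hle : (tmix (P n) (π n) θ : ℝ) ≤ m := by linarith
  exact (hP n).mixedAt_mono (by exact_mod_cast hle) (mixedAt_tmix_of_pos hpos)

theorem eventually_not_mixedAt_of_tendsto (ht : ∀ n, 0 < t n)
    {θ : ℝ} (hlim : Tendsto (fun n => (tmix (P n) (π n) θ : ℝ) / t n) atTop (nhds 1))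
    {δ : ℝ} (hδ : 0 < δ) :
    ∀ᶠ n in atTop, ∀ m : ℕ, m ≤ (1 - δ) * t n → ¬ mixedAt (P n) (π n) θ m := by
  filter_upwards [(tendsto_order.1 hlim).1 (1 - δ) (by linarith)] with n h1 m hm hmix
  rw [lt_div_iff₀ (ht n)] at h1
  have : (tmix (P n) (π n) θ : ℝ) ≤ m := by exact_mod_cast tmix_le hmix
  linarith

theorem hasCutoff_of_eventually_mixedAt (ht : ∀ n, 0 < t n) (htop : Tendsto t atTop atTop)
    (hmix : ∀ θ ∈ Set.Ioo (0 : ℝ) 1, ∀ δ ∈ Set.Ioc (0 : ℝ) 1, ∀ᶠ n in atTop, ∀ m : ℕ,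
      (1 + δ) * t n ≤ m → mixedAt (P n) (π n) θ m)
    (hnot : ∀ θ ∈ Set.Ioo (0 : ℝ) 1, ∀ δ ∈ Set.Ioc (0 : ℝ) 1, ∀ᶠ n in atTop, ∀ m : ℕ,
      m ≤ (1 - δ) * t n → ¬ mixedAt (P n) (π n) θ m) :
    hasCutoff fun n θ => tmix (P n) (π n) θ := by
  have hex : ∀ θ ∈ Set.Ioo (0 : ℝ) 1, ∀ᶠ n in atTop, ∃ m, mixedAt (P n) (π n) θ m :=
    fun θ hθ => (hmix θ hθ 1 ⟨one_pos, le_rfl⟩).mono fun n h => ⟨_, h _ (Nat.le_ceil _)⟩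
  refine hasCutoff_of_tendsto ht (fun θ hθ => tendsto_order.2 ⟨fun a ha => ?_, fun b hb => ?_⟩)
    fun θ₁ h₁ θ₂ h₂ => (hex θ₁ h₁).mono fun n h => tmix_anti h₂ h
  · have hδ : min (1 - a) 1 ∈ Set.Ioc (0 : ℝ) 1 :=
      ⟨lt_min (sub_pos.2 ha) one_pos, min_le_right _ _⟩
    filter_upwards [hnot θ hθ _ hδ, hex θ hθ] with n h1 h2
    rw [lt_div_iff₀ (ht n)]
    by_contra! h3
    refine h1 _ (h3.trans ?_) (mixedAt_tmix_of_exists h2)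
    exact mul_le_mul_of_nonneg_right (by linarith [min_le_left (1 - a) 1]) (ht n).le
  · have hδ : min ((b - 1) / 2) 1 ∈ Set.Ioc (0 : ℝ) 1 :=
      ⟨lt_min (by linarith) one_pos, min_le_right _ _⟩
    filter_upwards [hmix θ hθ _ hδ, htop.eventually_ge_atTop (2 / (b - 1))] with n h1 h2
    have h3 : (tmix (P n) (π n) θ : ℝ) ≤ ⌈(1 + min ((b - 1) / 2) 1) * t n⌉₊ := by
      exact_mod_cast tmix_le (h1 _ (Nat.le_ceil _))
    have h4 := Nat.ceil_lt_add_one (mul_nonneg (by linarith [hδ.1]) (ht n).le :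
      0 ≤ (1 + min ((b - 1) / 2) 1) * t n)
    have h5 : (1 + min ((b - 1) / 2) 1) * t n ≤ (1 + (b - 1) / 2) * t n :=
      mul_le_mul_of_nonneg_right (by linarith [min_le_left ((b - 1) / 2) 1]) (ht n).le
    rw [div_le_iff₀ (by linarith)] at h2
    rw [div_lt_iff₀ (ht n)]
    linarith

end Family

/-- If the lazy walks on `(G_n)` do not exhibit cutoff and
`ε_n ≍ 1/t_mix^{G_n,lazy}(1/4)`, then for any choice of perfect matchings the walks on
`(G_n*)` do not exhibit cutoff. -/
theorem stmt5 (Δ : ℕ)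
    (V : ℕ → Type) [∀ n, Fintype (V n)] [∀ n, DecidableEq (V n)]
    (G : ∀ n, SimpleGraph (V n)) [∀ n, DecidableRel (G n).Adj]
    (hconn : ∀ n, (G n).Connected)
    (heven : ∀ n, Even (Fintype.card (V n)))
    (hcard : Tendsto (fun n => Fintype.card (V n)) atTop atTop)
    (hdeg : ∀ n (x : V n), (G n).degree x ≤ Δ)
    (ε : ℕ → ℝ) (hε : ∀ n, ε n ∈ Set.Ioo (0 : ℝ) 1)
    (hnocut : ¬ hasCutoff (fun n θ =>
      tmix (lazyMatrix (srwMatrix (G n))) (srwPi (G n)) θ))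
    (cc CC : ℝ) (hcc : 0 < cc) (hccCC : cc ≤ CC)
    (hεcomp : ∀ n,
      cc ≤ ε n * (tmix (lazyMatrix (srwMatrix (G n))) (srwPi (G n)) (1/4) : ℝ) ∧
      ε n * (tmix (lazyMatrix (srwMatrix (G n))) (srwPi (G n)) (1/4) : ℝ) ≤ CC)
    (η : ∀ n, V n → V n) (hη : ∀ n, IsPerfectMatchingFn (η n)) :
    ¬ hasCutoff (fun n θ =>
      tmix (starMatrix (G n) (η n) (ε n)) (starPi (G n) (ε n)) θ) := by
  intro hcut
  obtain ⟨t, ht, hlim⟩ := hcut.exists_tendsto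
  have hne : ∀ n, Nonempty (V n) := fun n => (hconn n).nonempty
  have hd : ∀ n (x : V n), 0 < (G n).degree x := fun n x => by
    have hcard1 : 1 < Fintype.card (V n) := by
      have := Fintype.card_pos (α := V n)
      obtain ⟨k, hk⟩ := heven n
      omega
    have : Nontrivial (V n) := Fintype.one_lt_card_iff_nontrivial.1 hcard1
    exact (hconn n).preconnected.degree_pos_of_nontrivial x
  have hinv : ∀ n, Function.Involutive (η n) := fun n => (hη n).1
  have hS : ∀ n, RevChain (starMatrix (G n) (η n) (ε n)) (starPi (G n) (ε n)) := fun n =>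
    revChain_star (hd n) (hinv n) (hε n).1
  have hmix := fun θ hθ δ (hδ : 0 < δ) => eventually_mixedAt_of_tendsto hS ht (hlim θ hθ) hδ
  have hnot := fun θ hθ δ (hδ : 0 < δ) => eventually_not_mixedAt_of_tendsto ht (hlim θ hθ) hδ
  have htop : Tendsto t atTop atTop := by
    refine tendsto_atTop.2 fun b => ?_
    obtain ⟨m, hm⟩ := exists_nat_ge (2 * b)
    have hκ : (0 : ℝ) < ((Δ + 1 : ℝ)⁻¹) ^ m := by positivity
    have hκ1 : ((Δ + 1 : ℝ)⁻¹) ^ m ≤ 1 :=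
      pow_le_one₀ (by positivity) (inv_le_one_of_one_le₀ (by
        linarith [Nat.cast_nonneg (α := ℝ) Δ]))
    have hsmall : Tendsto (fun n => (Δ + 1 : ℝ) / Fintype.card (V n)) atTop (nhds 0) :=
      (tendsto_natCast_atTop_atTop.comp hcard).const_div_atTop _
    filter_upwards [hmix (((Δ + 1 : ℝ)⁻¹) ^ m / 4) ⟨by linarith, by linarith⟩ 1 one_pos,
      hsmall.eventually_lt_const (half_pos hκ)] with n h1 h2
    by_contra! h3
    have := pow_le_of_star_mixedAt (hd n) (hdeg n) (hinv n) (hε n).1 (hε n).2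
      (h1 m (by linarith))
    linarith
  have hCC : 0 < CC := hcc.trans_le hccCC
  have hεt : ∀ᶠ n in atTop, ε n * t n ≤ 2 * CC := by
    have hexp := Real.exp_pos CC
    have hfrac : (3 / 4 : ℝ) / (4 * (Real.exp CC + 32)) < 1 := by
      rw [div_lt_one (by positivity)]
      linarith
    have hfrac0 : 0 < (3 / 4 : ℝ) / (4 * (Real.exp CC + 32)) := by positivity
    filter_upwards [hnot (1 - (3 / 4) / (4 * (Real.exp CC + 32)))
      ⟨by linarith, by linarith⟩ (1 / 2) (by norm_num)] with n h1
    obtain ⟨hl, hu⟩ := hεcomp n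
    set T := tmix (lazyMatrix (srwMatrix (G n))) (srwPi (G n)) (1 / 4) with hT
    have hT0 : 0 < T := by
      rw [Nat.pos_iff_ne_zero]
      intro h
      simp only [h, Nat.cast_zero, mul_zero] at hl
      linarith
    have hmixT := mixedAt_tmix_of_pos hT0
    have hstar : mixedAt (starMatrix (G n) (η n) (ε n)) (starPi (G n) (ε n))
        (1 - (3 / 4) / (4 * (Real.exp CC + 32))) T := by
      refine (revChain_srw (hd n)).mixedAt_of_lazy_mixedAt (hS n) hexp (s := T)
        (fun x y => ?_) (srwPi_le (hd n) (hε n).1 (hε n).2) (by norm_num) ?_ ?_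
      · exact (srwMatrix_pow_le (hd n) (hinv n) (hε n).1 T x y).trans
          (mul_le_mul_of_nonneg_right (Real.exp_le_exp.2 hu) (((hS n).pow T).nonneg x y))
      · rw [Finset.filter_false_of_mem, Finset.sum_empty]
        · norm_num
        · intro k hk
          have := Finset.mem_range.1 hk
          omega
      · rw [show (1 - 3 / 4 : ℝ) = 1 / 4 by norm_num]
        exact hmixT
    have h2 : (1 - 1 / 2) * t n < T := by
      by_contra! h
      exact h1 T h hstar
    have h3 : ε n * t n ≤ ε n * (2 * T) :=
      mul_le_mul_of_nonneg_left (by linarith) (hε n).1.le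
    linarith
  refine hnocut (hasCutoff_of_eventually_mixedAt (t := fun n => 2 * t n)
    (fun n => by linarith [ht n]) (htop.const_mul_atTop two_pos)
    (fun θ hθ δ hδ => ?_) fun θ hθ δ hδ => ?_)
  · have hC : 0 < 2 * CC := by linarith
    set M := Real.exp (3 * (2 * CC)) with hM
    have hM1 : 1 ≤ M := Real.one_le_exp (by positivity)
    have hlog : 0 < Real.log (2 * M / θ) := by
      refine Real.log_pos ?_
      rw [lt_div_iff₀ hθ.1]
      linarith [hθ.2]
    obtain ⟨d, hd'⟩ : ∃ d, d = δ / 4 := ⟨_, rfl⟩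
    have hd0 : 0 < d := by linarith [hδ.1]
    have hd1 : d ≤ 1 / 4 := by linarith [hδ.2]
    set Γ := 4 / d * Real.log (2 * M / θ) with hΓ
    have hΓ0 : 0 < Γ := by positivity
    have hθM : θ / (8 * M) ∈ Set.Ioo (0 : ℝ) 1 := by
      refine ⟨div_pos hθ.1 (by positivity), ?_⟩
      rw [div_lt_one (by positivity)]
      linarith [hθ.2]
    have hθΓ : Real.exp (-(6 * Γ + 12 * (2 * CC))) / 2 ∈ Set.Ioo (0 : ℝ) 1 := by
      refine ⟨by positivity, ?_⟩
      have : Real.exp (-(6 * Γ + 12 * (2 * CC))) ≤ 1 :=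
        Real.exp_le_one_iff.2 (by linarith)
      linarith
    filter_upwards [hεt, htop.eventually_ge_atTop 1, htop.eventually_ge_atTop (2 / (3 * d)),
      htop.eventually_ge_atTop (5 / (d ^ 2 * θ)),
      htop.eventually_ge_atTop (6 * Γ + 12 * (2 * CC)), hmix _ hθM d hd0,
      hmix _ hθΓ 1 one_pos] with n h1 h2 h3 h4 h5 h6 h7 m hm
    refine lazy_mixedAt_of_star_mixedAt (hd n) (hinv n) (hε n).1 (hε n).2 h1 hd0 hd1 hθ.1 h2
      ?_ h4 h6 (srw_poincare_of_star_mixedAt (hd n) (hinv n) (hε n).1 h1 h2 hC hΓ0 h5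
        fun m hm => h7 m (by linarith)) hθ.2 hC m ?_
    · rw [div_le_iff₀ (by positivity)] at h3
      linarith
    · rw [hd']
      linarith
  · obtain ⟨d, hd'⟩ : ∃ d, d = δ / 4 := ⟨_, rfl⟩
    have hd0 : 0 < d := by linarith [hδ.1]
    have hd1 : d ≤ 1 / 4 := by linarith [hδ.2]
    have hθ1 : 0 < 1 - θ := sub_pos.2 hθ.2
    have hexp := Real.exp_pos (2 * CC)
    have hfrac : (1 - θ) / (4 * (Real.exp (2 * CC) + 32)) < 1 := by
      rw [div_lt_one (by positivity)]
      linarith [hθ.1]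
    have hfrac0 : 0 < (1 - θ) / (4 * (Real.exp (2 * CC) + 32)) := by positivity
    filter_upwards [hεt, htop.eventually_ge_atTop 1,
      htop.eventually_ge_atTop (2 / (d ^ 2 * (1 - θ))),
      hnot (1 - (1 - θ) / (4 * (Real.exp (2 * CC) + 32)))
        ⟨by linarith, by linarith⟩ d hd0] with n h1 h2 h3 h4 m hm
    refine not_lazy_mixedAt_of_star (hd n) (hinv n) (hε n).1 (hε n).2 h1 hd0 hd1 hθ.2 h2 h3 h4 m
      (hm.trans ?_)
    have : 0 < δ * t n := mul_pos hδ.1 (ht n)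
    rw [hd']
    linarith
end
end

section
/- Let I be a finite set of even cardinality with |I| ≥ 2, let (w_{i,j})_{(i,j)∈I×I} be non-negative real weights, and let η be a uniformly random perfect matching of I, i.e. a fixed-point-free involution of I chosen uniformly at random. Set m = (1/(|I|−1))·∑_{i∈I} ∑_{j∈I, j≠i} w_{i,j} and b = max_{i≠j}(w_{i,j}+w_{j,i}), and assume b > 0. Then for every a > 0, P(∑_{i∈I} w_{i,η(i)} < m − a) ≤ exp(−a²/(4·b·m)). -/
open Filter

noncomputable section

section RandomMatching

open Finset Real

variable {I : Type*} [DecidableEq I]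

/-- Conjugation of a pairing by the transposition of `j` and `k`. -/
def conjSwap (j k : I) (η : I → I) : I → I :=
  fun x => Equiv.swap j k (η (Equiv.swap j k x))

lemma conjSwap_conjSwap (j k : I) (η : I → I) : conjSwap j k (conjSwap j k η) = η := by
  funext x
  simp [conjSwap]

lemma conjSwap_isPerfectMatchingFn {η : I → I} (hη : IsPerfectMatchingFn η) (j k : I) :
    IsPerfectMatchingFn (conjSwap j k η) := by
  refine ⟨fun x => ?_, fun x hx => ?_⟩
  · simp [conjSwap, hη.1 (Equiv.swap j k x)]
  · exact hη.2 (Equiv.swap j k x) (by simpa [conjSwap] using congrArg (Equiv.swap j k) hx)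

variable [Fintype I]

/-- The weight of the pairing `η`. -/
def matchingWeight (w : I → I → ℝ) (η : I → I) : ℝ := ∑ i, w i (η i)

open Classical in
/-- The finset of perfect matchings. -/
def perfectMatchings (I : Type*) [Fintype I] [DecidableEq I] : Finset (I → I) :=
  univ.filter IsPerfectMatchingFn

/-- The unnormalised Laplace transform of the weight of a uniform perfect matching. -/
def matchingLaplace (w : I → I → ℝ) (θ : ℝ) : ℝ :=
  ∑ η ∈ perfectMatchings I, exp (-θ * matchingWeight w η)

lemma mem_perfectMatchings {η : I → I} : η ∈ perfectMatchings I ↔ IsPerfectMatchingFn η := by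
  simp [perfectMatchings]

/-- Switching a matching so that `i` is matched with `j` creates at most two new pairs. -/
lemma matchingWeight_conjSwap_le {w : I → I → ℝ} (hw : ∀ i j, 0 ≤ w i j) {b : ℝ} (hb0 : 0 ≤ b)
    (hb : ∀ i j, i ≠ j → w i j + w j i ≤ b) {η : I → I} (hη : IsPerfectMatchingFn η)
    {i j : I} (hij : i ≠ j) :
    matchingWeight w (conjSwap j (η i) η) ≤ matchingWeight w η + 2 * b := by
  obtain ⟨hinv, hfix⟩ := hη
  by_cases hk : j = η i
  · have : conjSwap j (η i) η = η := by
      funext x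
      simp [conjSwap, hk]
    rw [this]
    linarith
  have hki : η i ≠ i := hfix i
  have hlj : η j ≠ j := hfix j
  have hlk : η j ≠ η i := fun h => hij (hinv.injective h).symm
  have hli : η j ≠ i := fun h => hk (by rw [← h, hinv])
  have e1 : conjSwap j (η i) η i = j := by
    simp [conjSwap, Equiv.swap_apply_of_ne_of_ne hij hki.symm]
  have e2 : conjSwap j (η i) η j = i := by
    simp [conjSwap, hinv i, Equiv.swap_apply_of_ne_of_ne hij hki.symm]
  have e3 : conjSwap j (η i) η (η i) = η j := by
    simp [conjSwap, Equiv.swap_apply_of_ne_of_ne hlj hlk]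
  have e4 : conjSwap j (η i) η (η j) = η i := by
    simp [conjSwap, Equiv.swap_apply_of_ne_of_ne hlj hlk, hinv j]
  have eoff : ∀ x, x ≠ i → x ≠ j → x ≠ η i → x ≠ η j → conjSwap j (η i) η x = η x := by
    intro x h1 h2 h3 h4
    have h5 : η x ≠ j := fun h => h4 (by rw [← h, hinv])
    have h6 : η x ≠ η i := fun h => h1 (hinv.injective h)
    simp [conjSwap, Equiv.swap_apply_of_ne_of_ne h2 h3, Equiv.swap_apply_of_ne_of_ne h5 h6]
  have hsum : ∑ x ∈ ({i, j, η i, η j} : Finset I), w x (conjSwap j (η i) η x) ≤ 2 * b := by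
    rw [sum_insert (by simp [hij, hki.symm, hli.symm]), sum_insert (by simp [hk, hlj.symm]),
      sum_insert (by simp [hlk.symm]), sum_singleton, e1, e2, e3, e4]
    linarith [hb i j hij, hb _ _ hlk]
  unfold matchingWeight
  rw [← sum_add_sum_compl ({i, j, η i, η j} : Finset I) fun x => w x (conjSwap j (η i) η x),
    ← sum_add_sum_compl ({i, j, η i, η j} : Finset I) fun x => w x (η x)]
  have hoff : ∑ x ∈ ({i, j, η i, η j} : Finset I)ᶜ, w x (conjSwap j (η i) η x) =
      ∑ x ∈ ({i, j, η i, η j} : Finset I)ᶜ, w x (η x) := by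
    refine sum_congr rfl fun x hx => ?_
    simp only [mem_compl, mem_insert, mem_singleton, not_or] at hx
    rw [eoff x hx.1 hx.2.1 hx.2.2.1 hx.2.2.2]
  have hon : 0 ≤ ∑ x ∈ ({i, j, η i, η j} : Finset I), w x (η x) :=
    sum_nonneg fun x _ => hw _ _
  linarith

lemma matchingLaplace_fiber_le {w : I → I → ℝ} (hw : ∀ i j, 0 ≤ w i j) {b : ℝ} (hb0 : 0 ≤ b)
    (hb : ∀ i j, i ≠ j → w i j + w j i ≤ b) {θ : ℝ} (hθ : 0 ≤ θ) {i j k : I} (hij : i ≠ j)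
    (hik : i ≠ k) :
    exp (-(2 * b * θ)) *
        ∑ η ∈ perfectMatchings I with η i = k, exp (-θ * matchingWeight w η) ≤
      ∑ η ∈ perfectMatchings I with η i = j, exp (-θ * matchingWeight w η) := by
  have hbij : ∑ η ∈ perfectMatchings I with η i = k,
        exp (-θ * matchingWeight w (conjSwap j k η)) =
      ∑ η ∈ perfectMatchings I with η i = j, exp (-θ * matchingWeight w η) := by
    refine sum_nbij' (conjSwap j k) (conjSwap j k) ?_ ?_ ?_ ?_ ?_
    · intro η hη
      simp only [mem_filter, mem_perfectMatchings] at hη ⊢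
      exact ⟨conjSwap_isPerfectMatchingFn hη.1 j k,
        by simp [conjSwap, Equiv.swap_apply_of_ne_of_ne hij hik, hη.2]⟩
    · intro η hη
      simp only [mem_filter, mem_perfectMatchings] at hη ⊢
      exact ⟨conjSwap_isPerfectMatchingFn hη.1 j k,
        by simp [conjSwap, Equiv.swap_apply_of_ne_of_ne hij hik, hη.2]⟩
    · exact fun η _ => conjSwap_conjSwap j k η
    · exact fun η _ => conjSwap_conjSwap j k η
    · exact fun η _ => rfl
  rw [← hbij, mul_sum]
  refine sum_le_sum fun η hη => ?_
  simp only [mem_filter, mem_perfectMatchings] at hη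
  rw [← exp_add, exp_le_exp]
  have h := matchingWeight_conjSwap_le hw hb0 hb hη.1 hij
  rw [hη.2] at h
  nlinarith

lemma matchingLaplace_le_fiber {w : I → I → ℝ} (hw : ∀ i j, 0 ≤ w i j) {b : ℝ} (hb0 : 0 ≤ b)
    (hb : ∀ i j, i ≠ j → w i j + w j i ≤ b) {θ : ℝ} (hθ : 0 ≤ θ) {i j : I} (hij : i ≠ j) :
    exp (-(2 * b * θ)) * matchingLaplace w θ ≤ ((Fintype.card I : ℝ) - 1) *
      ∑ η ∈ perfectMatchings I with η i = j, exp (-θ * matchingWeight w η) := by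
  have hmaps : ∀ η ∈ perfectMatchings I, η i ∈ univ.erase i := fun η hη => by
    simpa using (mem_perfectMatchings.1 hη).2 i
  have hcard : ((univ.erase i).card : ℝ) = (Fintype.card I : ℝ) - 1 := by
    rw [card_erase_of_mem (mem_univ i), card_univ,
      Nat.cast_sub (Fintype.card_pos_iff.2 ⟨i⟩), Nat.cast_one]
  rw [matchingLaplace, ← sum_fiberwise_of_maps_to hmaps, mul_sum, ← hcard, ← nsmul_eq_mul]
  exact sum_le_card_nsmul _ _ _ fun k hk =>
    matchingLaplace_fiber_le hw hb0 hb hθ hij (ne_of_mem_erase hk).symm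

/-- The size-bias inequality for the weight of a uniform perfect matching. -/
lemma mul_matchingLaplace_le {w : I → I → ℝ} (hw : ∀ i j, 0 ≤ w i j) {b : ℝ} (hb0 : 0 ≤ b)
    (hb : ∀ i j, i ≠ j → w i j + w j i ≤ b) (h2 : 2 ≤ Fintype.card I) {θ : ℝ} (hθ : 0 ≤ θ) :
    ((Fintype.card I : ℝ) - 1)⁻¹ * (∑ i, ∑ j ∈ univ.erase i, w i j) *
        (exp (-(2 * b * θ)) * matchingLaplace w θ) ≤
      ∑ η ∈ perfectMatchings I, matchingWeight w η * exp (-θ * matchingWeight w η) := by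
  have hn : (0 : ℝ) < (Fintype.card I : ℝ) - 1 := by
    have : (2 : ℝ) ≤ Fintype.card I := by exact_mod_cast h2
    linarith
  have hexp : ∑ η ∈ perfectMatchings I, matchingWeight w η * exp (-θ * matchingWeight w η) =
      ∑ i, ∑ j ∈ univ.erase i, w i j *
        ∑ η ∈ perfectMatchings I with η i = j, exp (-θ * matchingWeight w η) := by
    conv_lhs => enter [2, η]; rw [matchingWeight, sum_mul]
    rw [sum_comm]
    refine sum_congr rfl fun i _ => ?_
    have hmaps : ∀ η ∈ perfectMatchings I, η i ∈ univ.erase i := fun η hη => by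
      simpa using (mem_perfectMatchings.1 hη).2 i
    rw [← sum_fiberwise_of_maps_to hmaps]
    refine sum_congr rfl fun j _ => ?_
    rw [mul_sum]
    refine sum_congr rfl fun η hη => ?_
    rw [(mem_filter.1 hη).2]
    rfl
  rw [hexp, mul_sum, sum_mul]
  refine sum_le_sum fun i _ => ?_
  rw [mul_sum, sum_mul]
  refine sum_le_sum fun j hj => ?_
  have h := matchingLaplace_le_fiber hw hb0 hb hθ (ne_of_mem_erase hj).symm
  rw [mul_comm _ (w i j), mul_assoc]
  refine mul_le_mul_of_nonneg_left ?_ (hw i j)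
  rwa [inv_mul_le_iff₀ hn]

lemma hasDerivAt_matchingLaplace (w : I → I → ℝ) (θ : ℝ) :
    HasDerivAt (matchingLaplace w)
      (-∑ η ∈ perfectMatchings I, matchingWeight w η * exp (-θ * matchingWeight w η)) θ := by
  rw [← sum_neg_distrib]
  refine HasDerivAt.fun_sum fun η _ => ?_
  have h : HasDerivAt (fun t : ℝ => -t * matchingWeight w η) (-1 * matchingWeight w η) θ :=
    (hasDerivAt_id θ).neg.mul_const (matchingWeight w η)
  exact h.exp.congr_deriv (by ring)

/-- A function on `[0, ∞)` with `m e^{-2bθ} F(θ) ≤ -F'(θ)` decays at least like a Gaussian. -/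
lemma le_mul_exp_of_deriv_le {F F' : ℝ → ℝ} (hF : ∀ θ, HasDerivAt F (F' θ) θ)
    (hF0 : ∀ θ, 0 ≤ F θ) {m b : ℝ} (hm : 0 ≤ m)
    (hF' : ∀ θ, 0 ≤ θ → m * (exp (-(2 * b * θ)) * F θ) ≤ -F' θ) {θ : ℝ} (hθ : 0 ≤ θ) :
    F θ ≤ F 0 * exp (-(m * (θ - b * θ ^ 2))) := by
  have hder : ∀ t, HasDerivAt (fun t => F t * exp (m * (t - b * t ^ 2)))
      ((F' t + m * (1 - 2 * b * t) * F t) * exp (m * (t - b * t ^ 2))) t := by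
    intro t
    have h1 : HasDerivAt (fun t : ℝ => m * (t - b * t ^ 2)) (m * (1 - b * (2 * t))) t := by
      simpa using ((hasDerivAt_id t).sub (((hasDerivAt_id t).pow 2).const_mul b)).const_mul m
    exact ((hF t).mul h1.exp).congr_deriv (by ring)
  have hanti : AntitoneOn (fun t => F t * exp (m * (t - b * t ^ 2))) (Set.Ici 0) := by
    refine antitoneOn_of_deriv_nonpos (convex_Ici 0)
      (fun t _ => (hder t).continuousAt.continuousWithinAt)
      (fun t _ => (hder t).differentiableAt.differentiableWithinAt) fun t ht => ?_
    rw [interior_Ici, Set.mem_Ioi] at ht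
    rw [(hder t).deriv]
    refine mul_nonpos_of_nonpos_of_nonneg ?_ (exp_pos _).le
    have h1 : 1 - 2 * b * t ≤ exp (-(2 * b * t)) := by
      linarith [add_one_le_exp (-(2 * b * t))]
    have h2 := mul_le_mul_of_nonneg_right h1 (mul_nonneg hm (hF0 t))
    linarith [hF' t ht.le]
  have h := hanti (Set.mem_Ici.2 le_rfl) (Set.mem_Ici.2 hθ) hθ
  simp only [ne_eq, OfNat.ofNat_ne_zero, not_false_eq_true, zero_pow, mul_zero, sub_zero, exp_zero,
    mul_one] at h
  rw [exp_neg, ← div_eq_mul_inv, le_div_iff₀ (exp_pos _)]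
  exact h

lemma matchingProb_eq_card_div (E : (I → I) → Prop) [DecidablePred E] :
    matchingProb I E = ((perfectMatchings I).filter E).card / (perfectMatchings I).card := by
  classical
  rw [matchingProb, Nat.card_eq_fintype_card, Nat.card_eq_fintype_card,
    Fintype.card_subtype, Fintype.card_subtype, perfectMatchings, filter_filter]

/-- The exponential Markov inequality for the lower tail of the weight of a random matching. -/
lemma card_filter_matchingWeight_lt_le (w : I → I → ℝ) {θ : ℝ} (hθ : 0 ≤ θ) (t : ℝ) :
    (((perfectMatchings I).filter fun η => matchingWeight w η < t).card : ℝ) ≤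
      exp (θ * t) * matchingLaplace w θ := by
  rw [card_eq_sum_ones, Nat.cast_sum, matchingLaplace, mul_sum]
  refine (sum_le_sum fun η hη => ?_).trans
    (sum_le_sum_of_subset_of_nonneg (filter_subset _ _) fun η _ _ => by positivity)
  rw [← exp_add, Nat.cast_one, one_le_exp_iff]
  nlinarith [(mem_filter.1 hη).2]

end RandomMatching

/-- Lemma 5.1 of BHKL / Chatterjee.  For non-negative weights `w` and a
uniformly random perfect matching `η` of a finite set `I` of even size,
`P(∑ᵢ w_{i,η(i)} < m - a) ≤ exp(-a²/(4bm))`. -/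
theorem stmt6 (I : Type*) [Fintype I] [DecidableEq I]
    (heven : Even (Fintype.card I)) (h2 : 2 ≤ Fintype.card I)
    (w : I → I → ℝ) (hw : ∀ i j, 0 ≤ w i j)
    (m b : ℝ)
    (hm : m = ((Fintype.card I : ℝ) - 1)⁻¹ * ∑ i, ∑ j ∈ Finset.univ.erase i, w i j)
    (hb : b = sSup {x : ℝ | ∃ i j : I, i ≠ j ∧ x = w i j + w j i})
    (hbpos : 0 < b)
    (a : ℝ) (ha : 0 < a) :
    matchingProb I (fun η => ∑ i, w i (η i) < m - a) ≤ Real.exp (-(a ^ 2 / (4 * b * m))) := by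
  have hb' : ∀ i j, i ≠ j → w i j + w j i ≤ b := by
    intro i j hij
    rw [hb]
    refine le_csSup (Set.Finite.bddAbove ?_) ⟨i, j, hij, rfl⟩
    refine (Set.finite_range fun p : I × I => w p.1 p.2 + w p.2 p.1).subset ?_
    rintro x ⟨i, j, -, rfl⟩
    exact ⟨(i, j), rfl⟩
  have hn : (0 : ℝ) < (Fintype.card I : ℝ) - 1 := by
    have : (2 : ℝ) ≤ Fintype.card I := by exact_mod_cast h2
    linarith
  have hm0 : 0 ≤ m := by
    rw [hm]
    exact mul_nonneg (inv_nonneg.2 hn.le)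
      (Finset.sum_nonneg fun i _ => Finset.sum_nonneg fun j _ => hw i j)
  have hprob := matchingProb_eq_card_div fun η : I → I => matchingWeight w η < m - a
  change matchingProb I (fun η => matchingWeight w η < m - a) ≤ _
  rw [hprob]
  rcases hm0.eq_or_lt with hm0' | hmpos
  · rw [← hm0']
    simp only [mul_zero, div_zero, neg_zero, Real.exp_zero]
    exact div_le_one_of_le₀ (by exact_mod_cast Finset.card_filter_le _ _) (Nat.cast_nonneg _)
  have hθ : 0 ≤ a / (2 * b * m) := by positivity
  have hlap := le_mul_exp_of_deriv_le (hasDerivAt_matchingLaplace w)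
    (fun θ => Finset.sum_nonneg fun η _ => (Real.exp_pos _).le) hm0 (b := b)
    (fun θ hθ => by
      rw [hm, neg_neg]
      exact mul_matchingLaplace_le hw hbpos.le hb' h2 hθ) hθ
  have hzero : matchingLaplace w 0 = (perfectMatchings I).card := by simp [matchingLaplace]
  refine div_le_of_le_mul₀ (Nat.cast_nonneg _) (Real.exp_pos _).le ?_
  refine (card_filter_matchingWeight_lt_le w hθ (m - a)).trans
    ((mul_le_mul_of_nonneg_left hlap (Real.exp_pos _).le).trans_eq ?_)
  rw [hzero, mul_left_comm, ← Real.exp_add, mul_comm]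
  congr 2
  field_simp
  ring
end
end

section
/- Let Δ ∈ ℕ and A > 0. There exists a constant c > 0 depending only on Δ and A such that for every finite connected simple graph G on n vertices with all vertex degrees at most Δ, all vertices x and y, and every integer t with 1 ≤ t < A·n², the simple random walk on G satisfies P_G^t(x,y) ≤ c/√t. -/
open Filter

noncomputable section

section TwoStep

variable {V : Type*}

/-- Distinct vertices are adjacent in the two-step graph when they have a common neighbour. -/
def twoStepGraph (G : SimpleGraph V) : SimpleGraph V where
  Adj a b := a ≠ b ∧ ∃ m, G.Adj m a ∧ G.Adj m b
  symm := ⟨fun _ _ ⟨hne, m, ha, hb⟩ => ⟨hne.symm, m, hb, ha⟩⟩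
  loopless := ⟨fun _ h => h.1 rfl⟩

/-- Every vertex of a connected graph is two-step reachable from `x`, or adjacent to such a
vertex. -/
lemma twoStepGraph_reachable_or_adj {G : SimpleGraph V} (hG : G.Connected) (x v : V) :
    (twoStepGraph G).Reachable x v ∨ ∃ m, (twoStepGraph G).Reachable x m ∧ G.Adj m v := by
  obtain ⟨p⟩ := (hG x v).symm
  induction p with
  | nil => exact Or.inl (SimpleGraph.Reachable.refl _)
  | @cons w v x hwv _ ih =>
    rcases ih with h | ⟨m, hm, hmv⟩
    · exact Or.inr ⟨v, h, hwv.symm⟩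
    · by_cases hmw : m = w
      · exact Or.inl (hmw ▸ hm)
      · exact Or.inl (hm.trans (SimpleGraph.Adj.reachable ⟨hmw, v, hmv.symm, hwv.symm⟩))

variable [Fintype V] [DecidableEq V] {G : SimpleGraph V} [DecidableRel G.Adj]

lemma card_le_card_twoStep_component_mul (hG : G.Connected) {Δ : ℕ} (hΔ : ∀ v, G.degree v ≤ Δ)
    (x : V) (C : Finset V) (hC : ∀ v, (twoStepGraph G).Reachable x v → v ∈ C) :
    Fintype.card V ≤ C.card * (Δ + 1) := by
  have hcover : (Finset.univ : Finset V) ⊆ C.biUnion fun c => insert c (G.neighborFinset c) := by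
    intro v _
    rw [Finset.mem_biUnion]
    rcases twoStepGraph_reachable_or_adj hG x v with h | ⟨m, hm, hmv⟩
    · exact ⟨v, hC v h, Finset.mem_insert_self _ _⟩
    · exact ⟨m, hC m hm, Finset.mem_insert_of_mem (by simpa using hmv)⟩
  calc Fintype.card V ≤ (C.biUnion fun c => insert c (G.neighborFinset c)).card :=
        Finset.card_le_card hcover
    _ ≤ C.card * (Δ + 1) := by
        refine Finset.card_biUnion_le_card_mul _ _ _ fun c _ => ?_
        refine (Finset.card_insert_le _ _).trans ?_
        have := hΔ c
        rw [← G.card_neighborFinset_eq_degree] at this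
        omega

/-- If some vertex two-step reachable from `x` lies outside `S`, then `f` can be telescoped along
a two-step path from `x` out of `S` with at most `S.card` edges. -/
lemma exists_notMem_sq_sub_le (f : V → ℝ) (x : V) (S : Finset V)
    (hS : ∃ z, (twoStepGraph G).Reachable x z ∧ z ∉ S) :
    ∃ z, z ∉ S ∧ (f x - f z) ^ 2 ≤
      S.card * ∑ m, ∑ a ∈ G.neighborFinset m, ∑ b ∈ G.neighborFinset m, (f a - f b) ^ 2 := by
  classical
  set H := twoStepGraph G with hH
  obtain ⟨z, hz, hmin⟩ := Finset.exists_min_image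
    (Finset.univ.filter fun z => H.Reachable x z ∧ z ∉ S) (fun z => H.dist x z)
    (by obtain ⟨z, hz⟩ := hS; exact ⟨z, by simpa using hz⟩)
  simp only [Finset.mem_filter, Finset.mem_univ, true_and] at hz hmin
  obtain ⟨p, hp⟩ := hz.1.exists_walk_length_eq_dist
  have hpath : p.IsPath := p.isPath_of_length_eq_dist hp
  have hmem : ∀ i < p.length, p.getVert i ∈ S := by
    intro i hi
    by_contra hcon
    have h1 := hmin _ ⟨(p.take i).reachable, hcon⟩
    have h2 := H.dist_le (p.take i)
    rw [SimpleGraph.Walk.take_length] at h2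
    omega
  have hinj : Set.InjOn p.getVert (Finset.range p.length : Set ℕ) :=
    hpath.getVert_injOn.mono fun i hi => by
      have : i < p.length := by simpa using hi
      exact this.le
  have hcard : p.length ≤ S.card := by
    have := Finset.card_le_card_of_injOn p.getVert
      (fun i hi => hmem i (Finset.mem_range.mp hi)) hinj
    simpa using this
  have hedges : ∑ i ∈ Finset.range p.length, (f (p.getVert i) - f (p.getVert (i + 1))) ^ 2 ≤
      ∑ m, ∑ a ∈ G.neighborFinset m, ∑ b ∈ G.neighborFinset m, (f a - f b) ^ 2 := by
    have hadj : ∀ i : ℕ, ∃ m, i < p.length →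
        G.Adj m (p.getVert i) ∧ G.Adj m (p.getVert (i + 1)) := by
      intro i
      by_cases hi : i < p.length
      · obtain ⟨_, m, hm⟩ := p.adj_getVert_succ hi
        exact ⟨m, fun _ => hm⟩
      · exact ⟨x, fun h => absurd h hi⟩
    choose mid hmid using hadj
    let e : ℕ → Σ _ : V, V × V := fun i => ⟨mid i, p.getVert i, p.getVert (i + 1)⟩
    have he : Set.InjOn e (Finset.range p.length : Set ℕ) := by
      intro i hi j hj hij
      have : (e i).2.1 = (e j).2.1 := by rw [hij]
      exact hinj hi hj this
    have hsig : ∑ m, ∑ a ∈ G.neighborFinset m, ∑ b ∈ G.neighborFinset m, (f a - f b) ^ 2 =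
        ∑ q ∈ Finset.univ.sigma fun m => G.neighborFinset m ×ˢ G.neighborFinset m,
          (f q.2.1 - f q.2.2) ^ 2 := by
      rw [Finset.sum_sigma]
      simp only [Finset.sum_product]
    rw [hsig, ← Finset.sum_image (g := e) (f := fun q => (f q.2.1 - f q.2.2) ^ 2) he]
    refine Finset.sum_le_sum_of_subset_of_nonneg ?_ fun _ _ _ => sq_nonneg _
    intro q hq
    obtain ⟨i, hi, rfl⟩ := Finset.mem_image.mp hq
    simpa [e] using hmid i (Finset.mem_range.mp hi)
  refine ⟨z, hz.2, ?_⟩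
  have htel : f x - f z =
      ∑ i ∈ Finset.range p.length, (f (p.getVert i) - f (p.getVert (i + 1))) := by
    rw [Finset.sum_range_sub' fun i => f (p.getVert i)]
    simp
  calc (f x - f z) ^ 2
      ≤ p.length * ∑ i ∈ Finset.range p.length,
          (f (p.getVert i) - f (p.getVert (i + 1))) ^ 2 := by
        rw [htel]
        simpa using sq_sum_le_card_mul_sum_sq (s := Finset.range p.length)
          (f := fun i => f (p.getVert i) - f (p.getVert (i + 1)))
    _ ≤ _ := by gcongr

end TwoStep

section HeatKernel

variable {V : Type*} [Fintype V] {G : SimpleGraph V} [DecidableRel G.Adj]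

lemma srwMatrix_nonneg (a b : V) : 0 ≤ srwMatrix G a b := by
  unfold srwMatrix
  split_ifs <;> positivity

lemma sum_srwMatrix (hdeg : ∀ v, 0 < G.degree v) (a : V) : ∑ b, srwMatrix G a b = 1 := by
  have ha : (G.degree a : ℝ) ≠ 0 := by exact_mod_cast (hdeg a).ne'
  simp only [srwMatrix]
  rw [← Finset.sum_filter, Finset.sum_const, ← G.neighborFinset_eq_filter,
    G.card_neighborFinset_eq_degree, nsmul_eq_mul, mul_inv_cancel₀ ha]

lemma sum_degree_mul_eq_sum_neighborFinset (g : V → ℝ) :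
    ∑ a, G.degree a * g a = ∑ m, ∑ a ∈ G.neighborFinset m, g a := by
  simp only [G.neighborFinset_eq_filter, Finset.sum_filter]
  rw [Finset.sum_comm]
  refine Finset.sum_congr rfl fun a _ => ?_
  rw [← G.card_neighborFinset_eq_degree, ← nsmul_eq_mul, ← Finset.sum_const,
    G.neighborFinset_eq_filter, Finset.sum_filter]
  simp only [G.adj_comm]

lemma degree_mul_srwMatrix (hdeg : ∀ v, 0 < G.degree v) (a b : V) :
    G.degree a * srwMatrix G a b = G.degree b * srwMatrix G b a := by
  have ha : (G.degree a : ℝ) ≠ 0 := by exact_mod_cast (hdeg a).ne'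
  have hb : (G.degree b : ℝ) ≠ 0 := by exact_mod_cast (hdeg b).ne'
  by_cases h : G.Adj a b
  · simp [srwMatrix, h, h.symm, ha, hb]
  · simp [srwMatrix, h, mt SimpleGraph.Adj.symm h]

variable [DecidableEq V]

variable (G) in
/-- The transition density of the simple random walk with respect to the degree measure. -/
def heatKernel (s : ℕ) (a b : V) : ℝ := (srwMatrix G ^ s) a b / G.degree b

lemma srwMatrix_pow_nonneg (s : ℕ) (a b : V) : 0 ≤ (srwMatrix G ^ s) a b := by
  induction s generalizing b with
  | zero => rw [pow_zero, Matrix.one_apply]; split_ifs <;> norm_num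
  | succ s ih =>
    rw [pow_succ, Matrix.mul_apply]
    exact Finset.sum_nonneg fun m _ => mul_nonneg (ih m) (srwMatrix_nonneg m b)

lemma sum_srwMatrix_pow (hdeg : ∀ v, 0 < G.degree v) (s : ℕ) (a : V) :
    ∑ b, (srwMatrix G ^ s) a b = 1 := by
  induction s with
  | zero => simp [Matrix.one_apply]
  | succ s ih =>
    simp only [pow_succ, Matrix.mul_apply]
    rw [Finset.sum_comm]
    simp only [← Finset.mul_sum, sum_srwMatrix hdeg, mul_one, ih]

lemma degree_mul_srwMatrix_pow (hdeg : ∀ v, 0 < G.degree v) (s : ℕ) (a b : V) :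
    G.degree a * (srwMatrix G ^ s) a b = G.degree b * (srwMatrix G ^ s) b a := by
  induction s generalizing a b with
  | zero =>
    by_cases h : a = b
    · rw [h]
    · simp [h, Ne.symm h]
  | succ s ih =>
    rw [pow_succ, Matrix.mul_apply, ← pow_succ, pow_succ', Matrix.mul_apply, Finset.mul_sum,
      Finset.mul_sum]
    refine Finset.sum_congr rfl fun m _ => ?_
    rw [← mul_assoc, ih, ← mul_assoc, degree_mul_srwMatrix hdeg b m]
    ring

lemma heatKernel_nonneg (s : ℕ) (a b : V) : 0 ≤ heatKernel G s a b :=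
  div_nonneg (srwMatrix_pow_nonneg s a b) (Nat.cast_nonneg _)

lemma heatKernel_comm (hdeg : ∀ v, 0 < G.degree v) (s : ℕ) (a b : V) :
    heatKernel G s a b = heatKernel G s b a := by
  have ha : (G.degree a : ℝ) ≠ 0 := by exact_mod_cast (hdeg a).ne'
  have hb : (G.degree b : ℝ) ≠ 0 := by exact_mod_cast (hdeg b).ne'
  unfold heatKernel
  rw [div_eq_div_iff hb ha]
  linarith [degree_mul_srwMatrix_pow hdeg s a b]

lemma degree_mul_heatKernel (hdeg : ∀ v, 0 < G.degree v) (s : ℕ) (a b : V) :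
    G.degree b * heatKernel G s a b = (srwMatrix G ^ s) a b :=
  mul_div_cancel₀ _ (by exact_mod_cast (hdeg b).ne')

lemma sum_degree_mul_heatKernel (hdeg : ∀ v, 0 < G.degree v) (s : ℕ) (a : V) :
    ∑ b, G.degree b * heatKernel G s a b = 1 := by
  simp only [degree_mul_heatKernel hdeg, sum_srwMatrix_pow hdeg]

/-- The Chapman–Kolmogorov equation for the symmetric density. -/
lemma heatKernel_add (hdeg : ∀ v, 0 < G.degree v) (s t : ℕ) (a b : V) :
    heatKernel G (s + t) a b = ∑ m, G.degree m * (heatKernel G s a m * heatKernel G t b m) := by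
  simp only [← mul_assoc, degree_mul_heatKernel hdeg, heatKernel_comm hdeg t b]
  rw [heatKernel, pow_add, Matrix.mul_apply, Finset.sum_div]
  exact Finset.sum_congr rfl fun m _ => mul_div_assoc _ _ _

lemma degree_mul_heatKernel_succ (hdeg : ∀ v, 0 < G.degree v) (s : ℕ) (a m : V) :
    G.degree m * heatKernel G (s + 1) a m = ∑ b ∈ G.neighborFinset m, heatKernel G s a b := by
  rw [degree_mul_heatKernel hdeg, pow_succ, Matrix.mul_apply, G.neighborFinset_eq_filter,
    Finset.sum_filter]
  refine Finset.sum_congr rfl fun b _ => ?_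
  by_cases h : G.Adj m b
  · simp [srwMatrix, heatKernel, h, h.symm, div_eq_mul_inv]
  · simp [srwMatrix, h, mt SimpleGraph.Adj.symm h]

lemma sum_sum_sq_sub {ι : Type*} (N : Finset ι) (g : ι → ℝ) :
    ∑ a ∈ N, ∑ b ∈ N, (g a - g b) ^ 2 = 2 * (N.card * ∑ a ∈ N, g a ^ 2 - (∑ a ∈ N, g a) ^ 2) := by
  simp only [sub_sq, Finset.sum_add_distrib, Finset.sum_sub_distrib, Finset.sum_const,
    nsmul_eq_mul, ← Finset.mul_sum, ← Finset.sum_mul]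
  ring

/-- The two-step Dirichlet form of the density at time `s` is bounded by the decrement of the
on-diagonal density. -/
lemma sum_sq_sub_heatKernel_le (hdeg : ∀ v, 0 < G.degree v) {Δ : ℕ} (hΔ : ∀ v, G.degree v ≤ Δ)
    (s : ℕ) (x : V) :
    ∑ m, ∑ a ∈ G.neighborFinset m, ∑ b ∈ G.neighborFinset m,
        (heatKernel G s x a - heatKernel G s x b) ^ 2 ≤
      2 * Δ * (heatKernel G (2 * s) x x - heatKernel G (2 * s + 2) x x) := by
  have h₁ : heatKernel G (2 * s) x x =
      ∑ m, ∑ a ∈ G.neighborFinset m, heatKernel G s x a ^ 2 := by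
    rw [two_mul, heatKernel_add hdeg, ← sum_degree_mul_eq_sum_neighborFinset]
    simp only [sq]
  have h₂ : heatKernel G (2 * s + 2) x x =
      ∑ m, G.degree m * heatKernel G (s + 1) x m ^ 2 := by
    rw [show 2 * s + 2 = (s + 1) + (s + 1) by ring, heatKernel_add hdeg]
    simp only [sq]
  rw [h₁, h₂, ← Finset.sum_sub_distrib, Finset.mul_sum]
  refine Finset.sum_le_sum fun m _ => ?_
  have hm : (0 : ℝ) < G.degree m := by exact_mod_cast hdeg m
  have hmΔ : (G.degree m : ℝ) ≤ Δ := by exact_mod_cast hΔ m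
  have hvar := sum_sum_sq_sub (G.neighborFinset m) (heatKernel G s x)
  have hnonneg : 0 ≤ ∑ a ∈ G.neighborFinset m, ∑ b ∈ G.neighborFinset m,
      (heatKernel G s x a - heatKernel G s x b) ^ 2 :=
    Finset.sum_nonneg fun _ _ => Finset.sum_nonneg fun _ _ => sq_nonneg _
  rw [G.card_neighborFinset_eq_degree, ← degree_mul_heatKernel_succ hdeg] at hvar
  rw [hvar] at hnonneg ⊢
  set Q := ∑ a ∈ G.neighborFinset m, heatKernel G s x a ^ 2
  set h := heatKernel G (s + 1) x m
  have hfac : 2 * (G.degree m * Q - (G.degree m * h) ^ 2) =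
      G.degree m * (2 * (Q - G.degree m * h ^ 2)) := by ring
  rw [hfac] at hnonneg ⊢
  have := nonneg_of_mul_nonneg_right hnonneg hm
  nlinarith [mul_le_mul_of_nonneg_right hmΔ this]

lemma heatKernel_diag_convex (hdeg : ∀ v, 0 < G.degree v) (s : ℕ) (x : V) :
    heatKernel G (2 * (s + 1)) x x - heatKernel G (2 * (s + 2)) x x ≤
      heatKernel G (2 * s) x x - heatKernel G (2 * (s + 1)) x x := by
  have h : heatKernel G (2 * s) x x - 2 * heatKernel G (2 * (s + 1)) x x +
      heatKernel G (2 * (s + 2)) x x =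
      ∑ m, G.degree m * (heatKernel G s x m - heatKernel G (s + 2) x m) ^ 2 := by
    rw [show 2 * s = s + s by ring, show 2 * (s + 1) = s + (s + 2) by ring,
      show 2 * (s + 2) = (s + 2) + (s + 2) by ring, heatKernel_add hdeg, heatKernel_add hdeg,
      heatKernel_add hdeg, Finset.mul_sum, ← Finset.sum_sub_distrib, ← Finset.sum_add_distrib]
    exact Finset.sum_congr rfl fun m _ => by ring
  have hnonneg : 0 ≤ ∑ m, (G.degree m : ℝ) * (heatKernel G s x m - heatKernel G (s + 2) x m) ^ 2 :=
    Finset.sum_nonneg fun m _ => by positivity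
  linarith

/-- A nonnegative convex sequence `u` satisfies `s (u (2s) - u (2s+1)) ≤ u s`. -/
lemma mul_sub_le_of_convex {u : ℕ → ℝ} (hu : ∀ s, 0 ≤ u s)
    (hconv : ∀ s, u (s + 1) - u (s + 2) ≤ u s - u (s + 1)) (s : ℕ) :
    s * (u (2 * s) - u (2 * s + 1)) ≤ u s := by
  have hanti : Antitone fun s => u s - u (s + 1) := antitone_nat_of_succ_le hconv
  have hsum : ∑ i ∈ Finset.range s, (u (s + i) - u (s + i + 1)) = u s - u (2 * s) := by
    have := Finset.sum_range_sub' (fun i => u (s + i)) s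
    simpa [two_mul, add_assoc] using this
  have hle : (Finset.range s).card • (u (2 * s) - u (2 * s + 1)) ≤
      ∑ i ∈ Finset.range s, (u (s + i) - u (s + i + 1)) := by
    refine Finset.card_nsmul_le_sum _ _ _ fun i hi => ?_
    have := Finset.mem_range.mp hi
    exact hanti (show s + i ≤ 2 * s by omega)
  rw [Finset.card_range, nsmul_eq_mul, hsum] at hle
  linarith [hu (2 * s)]

lemma heatKernel_diag_bound (hG : G.Connected) (hdeg : ∀ v, 0 < G.degree v) {Δ : ℕ}
    (hΔ : ∀ v, G.degree v ≤ Δ) (s : ℕ) (x : V) :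
    s * heatKernel G (2 * s) x x ^ 2 ≤ 16 * Δ ∨
      Fintype.card V * heatKernel G (2 * s) x x ≤ 2 * (Δ + 1) := by
  set f := heatKernel G (2 * s) x with hf
  set M := f x with hM
  have hM0 : 0 ≤ M := heatKernel_nonneg _ _ _
  rcases hM0.eq_or_lt with hM0 | hMpos
  · left
    rw [← hM0]
    simp
  let S : Finset V := Finset.univ.filter fun v => M / 2 ≤ f v
  have hScard : S.card * (M / 2) ≤ 1 := by
    rw [← sum_degree_mul_heatKernel hdeg (2 * s) x, ← nsmul_eq_mul]
    refine (Finset.card_nsmul_le_sum S (fun v => G.degree v * f v) _ fun v hv => ?_).trans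
      (Finset.sum_le_univ_sum_of_nonneg fun v =>
        mul_nonneg (Nat.cast_nonneg _) (heatKernel_nonneg _ _ _))
    have h1 : (1 : ℝ) ≤ G.degree v := by exact_mod_cast hdeg v
    have h2 : M / 2 ≤ f v := (Finset.mem_filter.mp hv).2
    nlinarith
  by_cases hS : ∃ z, (twoStepGraph G).Reachable x z ∧ z ∉ S
  · left
    obtain ⟨z, hz, hle⟩ := exists_notMem_sq_sub_le (G := G) f x S hS
    have hz : f z < M / 2 := by simpa [S] using hz
    have hE := sum_sq_sub_heatKernel_le hdeg hΔ (2 * s) x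
    have hu := mul_sub_le_of_convex (u := fun s => heatKernel G (2 * s) x x)
      (fun _ => heatKernel_nonneg _ _ _) (fun s => heatKernel_diag_convex hdeg s x) s
    simp only [mul_add, mul_one] at hu
    set E := heatKernel G (2 * (2 * s)) x x - heatKernel G (2 * (2 * s) + 2) x x
    have h1 : (M / 2) ^ 2 ≤ S.card * (2 * Δ * E) := by
      calc (M / 2) ^ 2 ≤ (f x - f z) ^ 2 := by
            apply pow_le_pow_left₀ (by positivity)
            linarith
        _ ≤ _ := hle.trans (by gcongr)
    have hcardpos : (0 : ℝ) ≤ S.card := Nat.cast_nonneg _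
    have h2 : 0 ≤ 2 * Δ * E :=
      le_trans (Finset.sum_nonneg fun _ _ => Finset.sum_nonneg fun _ _ =>
        Finset.sum_nonneg fun _ _ => sq_nonneg _) hE
    have h3 : M ^ 3 ≤ 16 * Δ * E := by
      have := mul_le_mul_of_nonneg_right h1 (show 0 ≤ M / 2 by positivity)
      have := mul_le_mul_of_nonneg_right hScard h2
      nlinarith
    have h4 : s * M ^ 3 ≤ 16 * Δ * M := by
      calc s * M ^ 3 ≤ s * (16 * Δ * E) := by gcongr
        _ = 16 * Δ * (s * E) := by ring
        _ ≤ 16 * Δ * M := by gcongr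
    refine le_of_mul_le_mul_right ?_ hMpos
    calc s * M ^ 2 * M = s * M ^ 3 := by ring
      _ ≤ _ := h4
  · right
    push Not at hS
    have hn : (Fintype.card V : ℝ) ≤ S.card * (Δ + 1) := by
      exact_mod_cast card_le_card_twoStep_component_mul hG hΔ x S hS
    calc Fintype.card V * M ≤ S.card * (Δ + 1) * M := by gcongr
      _ = 2 * (Δ + 1) * (S.card * (M / 2)) := by ring
      _ ≤ 2 * (Δ + 1) * 1 := by gcongr
      _ = 2 * (Δ + 1) := mul_one _

lemma heatKernel_le_diag (hdeg : ∀ v, 0 < G.degree v) (s : ℕ) (x y : V) :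
    heatKernel G (2 * s) x y ≤ (heatKernel G (2 * s) x x + heatKernel G (2 * s) y y) / 2 := by
  rw [two_mul, heatKernel_add hdeg, heatKernel_add hdeg, heatKernel_add hdeg,
    ← Finset.sum_add_distrib, Finset.sum_div]
  refine Finset.sum_le_sum fun m _ => ?_
  have hm : (0 : ℝ) ≤ G.degree m := Nat.cast_nonneg _
  nlinarith [mul_nonneg hm (sq_nonneg (heatKernel G s x m - heatKernel G s y m))]

lemma srwMatrix_pow_succ_le (hdeg : ∀ v, 0 < G.degree v) (s : ℕ) (y : V) {B : ℝ}
    (hB : ∀ z, (srwMatrix G ^ s) z y ≤ B) (x : V) : (srwMatrix G ^ (s + 1)) x y ≤ B := by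
  rw [pow_succ', Matrix.mul_apply]
  calc ∑ z, srwMatrix G x z * (srwMatrix G ^ s) z y ≤ ∑ z, srwMatrix G x z * B :=
        Finset.sum_le_sum fun z _ => mul_le_mul_of_nonneg_left (hB z) (srwMatrix_nonneg x z)
    _ = B := by rw [← Finset.sum_mul, sum_srwMatrix hdeg, one_mul]

/-- The on-diagonal bound at time `2s`, in terms of any `t ≤ 4s` with `t < A n²`. -/
lemma heatKernel_diag_le_div_sqrt (hG : G.Connected) (hdeg : ∀ v, 0 < G.degree v) {Δ : ℕ}
    (hΔ : ∀ v, G.degree v ≤ Δ) {A : ℝ} (hA : 0 < A) {s t : ℕ} (ht : 1 ≤ t) (hts : t ≤ 4 * s)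
    (htA : (t : ℝ) < A * (Fintype.card V : ℝ) ^ 2) (x : V) :
    heatKernel G (2 * s) x x ≤ (8 * √Δ + 2 * (Δ + 1) * √A) / √t := by
  set M := heatKernel G (2 * s) x x
  have hM0 : 0 ≤ M := heatKernel_nonneg _ _ _
  have htpos : (0 : ℝ) < t := by exact_mod_cast ht
  rw [le_div_iff₀ (Real.sqrt_pos.mpr htpos)]
  rcases heatKernel_diag_bound hG hdeg hΔ s x with h | h
  · have hts' : (t : ℝ) ≤ 4 * s := by exact_mod_cast hts
    have hsq : (M * √t) ^ 2 ≤ (8 * √Δ) ^ 2 := by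
      rw [mul_pow, mul_pow, Real.sq_sqrt htpos.le, Real.sq_sqrt (Nat.cast_nonneg _)]
      nlinarith [mul_le_mul_of_nonneg_left hts' (sq_nonneg M)]
    have := le_of_sq_le_sq hsq (by positivity)
    have : 0 ≤ 2 * (Δ + 1) * √A := by positivity
    linarith
  · have hsqrt : √t ≤ √A * Fintype.card V := by
      rw [← Real.sqrt_sq (Nat.cast_nonneg (Fintype.card V) : (0 : ℝ) ≤ _), ← Real.sqrt_mul hA.le]
      exact Real.sqrt_le_sqrt htA.le
    calc M * √t ≤ M * (√A * Fintype.card V) := by gcongr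
      _ = √A * (Fintype.card V * M) := by ring
      _ ≤ √A * (2 * (Δ + 1)) := by gcongr
      _ ≤ 8 * √Δ + 2 * (Δ + 1) * √A := by
        have : 0 ≤ 8 * √(Δ : ℝ) := by positivity
        linarith

lemma srwMatrix_pow_le_s8 (hG : G.Connected) (hdeg : ∀ v, 0 < G.degree v) {Δ : ℕ}
    (hΔ : ∀ v, G.degree v ≤ Δ) {A : ℝ} (hA : 0 < A) {s t : ℕ} (ht : 1 ≤ t) (hts : t ≤ 4 * s)
    (htA : (t : ℝ) < A * (Fintype.card V : ℝ) ^ 2) (x y : V) :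
    (srwMatrix G ^ (2 * s)) x y ≤ Δ * ((8 * √Δ + 2 * (Δ + 1) * √A) / √t) := by
  rw [← degree_mul_heatKernel hdeg]
  have hy : (G.degree y : ℝ) ≤ Δ := by exact_mod_cast hΔ y
  refine mul_le_mul hy ?_ (heatKernel_nonneg _ _ _) (Nat.cast_nonneg _)
  have h := heatKernel_diag_le_div_sqrt hG hdeg hΔ hA ht hts htA
  linarith [heatKernel_le_diag hdeg s x y, h x, h y]

end HeatKernel

/-- Uniform heat-kernel upper bound `P^t(x,y) ≤ c/√t` for `t < A·n²`
for the simple random walk on bounded-degree connected graphs. -/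
theorem stmt8 (Δ : ℕ) (A : ℝ) (hA : 0 < A) :
    ∃ c : ℝ, 0 < c ∧
      ∀ (V : Type) [Fintype V] [DecidableEq V] (G : SimpleGraph V) [DecidableRel G.Adj],
        G.Connected → (∀ x, G.degree x ≤ Δ) →
        ∀ (x y : V) (t : ℕ), 1 ≤ t → (t : ℝ) < A * (Fintype.card V : ℝ) ^ 2 →
          ((srwMatrix G) ^ t) x y ≤ c / Real.sqrt t := by
  refine ⟨Δ * (8 * √Δ + 2 * (Δ + 1) * √A) + 1, by positivity, ?_⟩
  intro V _ _ G _ hG hΔ x y t ht htA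
  rcases subsingleton_or_nontrivial V with hV | hV
  · have hzero : srwMatrix G = 0 := by
      ext a b
      simp [srwMatrix, Subsingleton.elim a b]
    rw [hzero, zero_pow (by omega), Matrix.zero_apply]
    positivity
  have hdeg : ∀ v, 0 < G.degree v := fun v => hG.preconnected.degree_pos_of_nontrivial v
  have hle : Δ * ((8 * √Δ + 2 * (Δ + 1) * √A) / √t) ≤
      (Δ * (8 * √Δ + 2 * (Δ + 1) * √A) + 1) / √t := by
    rw [← mul_div_assoc]
    gcongr
    linarith
  obtain ⟨s, rfl | rfl⟩ := t.even_or_odd'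
  · exact (srwMatrix_pow_le_s8 hG hdeg hΔ hA ht (by omega) htA x y).trans hle
  · rcases Nat.eq_zero_or_pos s with rfl | hs
    · refine (srwMatrix_pow_succ_le hdeg (2 * 0) y (B := 1) (fun z => ?_) x).trans ?_
      · rw [mul_zero, pow_zero, Matrix.one_apply]
        split_ifs <;> norm_num
      · simp only [mul_zero, zero_add, Nat.cast_one, Real.sqrt_one, div_one]
        exact le_add_of_nonneg_left (by positivity)
    · exact (srwMatrix_pow_succ_le hdeg (2 * s) y
        (fun z => srwMatrix_pow_le_s8 hG hdeg hΔ hA ht (by omega) htA z y) x).trans hle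
end
end
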